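/- arXiv:1203.5065 — 6 statements merged into one kernel-verified Lean document; each statement's English description precedes it below -/
import Mathlib

section
/- Let s ∈ S and I = S∖{s}. The short exact sequence of graded P-bimodules 0 → P → θ_s → Ps → 0, with first map a ↦ a(α_s⊗1 + 1⊗α_s) and second map a⊗b ↦ a·s(b), splits when regarded as a sequence of graded (P_I,P_I)-bimodules. -/
set_option synthInstance.maxHeartbeats 1000000
set_option maxHeartbeats 1000000

namespace Stmt5

open MvPolynomial TensorProduct

variable {B : Type*} [Fintype B] [DecidableEq B]

/-- The coefficient `2 cos (π / m_{st})`, so that `s · α_t = α_t + 2cos(π/m_{st}) α_s`. -/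
noncomputable def cc (M : CoxeterMatrix B) (s t : B) : ℂ :=
  ((2 * Real.cos (Real.pi / (M.M s t)) : ℝ) : ℂ)

/-- The polynomial algebra `P = ℂ[V] = Sym(V*)`, in the basis `{α_t}` of `V*`:
the variable `X t` corresponds to `α_t`, placed in degree `1`. -/
abbrev P (B : Type*) : Type _ := MvPolynomial B ℂ

/-- The action of the simple reflection `s` on `P`: `s · α_s = -α_s` and
`s · α_t = α_t + 2cos(π/m_{st}) α_s` for `t ≠ s`. -/
noncomputable def sAct (M : CoxeterMatrix B) (s : B) : P B →ₐ[ℂ] P B :=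
  aeval (fun t => if t = s then - X s else X t + C (cc M s t) * X s)

/-- The subalgebra `P^s` of `s`-invariant polynomials. -/
noncomputable def Psub (M : CoxeterMatrix B) (s : B) : Subalgebra ℂ (P B) :=
  AlgHom.equalizer (sAct M s) (AlgHom.id ℂ (P B))

/-- The graded `P`-bimodule `θ_s = P ⊗_{P^s} P`. -/
abbrev theta (M : CoxeterMatrix B) (s : B) : Type _ :=
  TensorProduct (Psub M s) (P B) (P B)

/-- The first map of the sequence, `a ↦ a·(α_s ⊗ 1 + 1 ⊗ α_s)`. -/
noncomputable def fmap (M : CoxeterMatrix B) (s : B) : P B →ₗ[ℂ] theta M s where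
  toFun a := (a * X s) ⊗ₜ[Psub M s] (1 : P B) + a ⊗ₜ[Psub M s] (X s)
  map_add' a b := by
    simp only [add_mul, TensorProduct.add_tmul]
    abel
  map_smul' c a := by
    simp only [smul_mul_assoc, TensorProduct.smul_tmul', smul_add, RingHom.id_apply]

/-- `s` as a `P^s`-algebra endomorphism of `P`. -/
noncomputable def sActR (M : CoxeterMatrix B) (s : B) : P B →ₐ[Psub M s] P B where
  toRingHom := (sAct M s).toRingHom
  commutes' := fun r => r.2

/-- The second map of the sequence, `θ_s → Ps`, `a ⊗ b ↦ a · s(b)`;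
recall that `Ps` has underlying set `P`, with left action by multiplication and right action
twisted by `s`. -/
noncomputable def tauMap (M : CoxeterMatrix B) (s : B) : theta M s →ₐ[Psub M s] P B :=
  Algebra.TensorProduct.productMap (AlgHom.id (Psub M s) (P B)) (sActR M s)

/-- The subalgebra `P_I ⊆ P` for `I = S ∖ {s}`: the subalgebra generated by the
`α_t` for `t ≠ s`. -/
noncomputable def PI (s : B) : Subalgebra ℂ (P B) :=
  Algebra.adjoin ℂ (MvPolynomial.X '' {t : B | t ≠ s})

set_option linter.unusedSectionVars false

theorem sAct_X_self (M : CoxeterMatrix B) (s : B) : sAct M s (X s) = -X s := by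
  simp [sAct]

theorem sAct_sAct (M : CoxeterMatrix B) (s : B) (p : P B) : sAct M s (sAct M s p) = p := by
  have h : (sAct M s).comp (sAct M s) = AlgHom.id ℂ (P B) := by
    refine MvPolynomial.algHom_ext fun t => ?_
    by_cases ht : t = s
    · subst ht
      simp [sAct_X_self]
    · have hX : sAct M s (X t) = X t + C (cc M s t) * X s := by simp [sAct, ht]
      have hC : sAct M s (C (cc M s t)) = C (cc M s t) := (sAct M s).commutes _
      rw [AlgHom.comp_apply, hX, map_add, map_mul, hX, hC, sAct_X_self, AlgHom.id_apply]
      ring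
  exact DFunLike.congr_fun h p

theorem X_dvd_sub_sAct (M : CoxeterMatrix B) (s : B) (p : P B) :
    (X s : P B) ∣ p - sAct M s p := by
  let q := Ideal.Quotient.mkₐ ℂ (Ideal.span {(X s : P B)})
  have hq : q (X s) = 0 := Ideal.Quotient.eq_zero_iff_mem.2 (Ideal.mem_span_singleton_self _)
  have h : q.comp (sAct M s) = q := by
    refine MvPolynomial.algHom_ext fun t => ?_
    by_cases ht : t = s
    · subst ht
      simp [sAct_X_self, hq]
    · have hX : sAct M s (X t) = X t + C (cc M s t) * X s := by simp [sAct, ht]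
      rw [AlgHom.comp_apply, hX, map_add, map_mul, hq, mul_zero, add_zero]
  rw [← Ideal.mem_span_singleton]
  exact Ideal.Quotient.eq.1 (DFunLike.congr_fun h p).symm

/-- Setting the variable `X s` to zero. -/
noncomputable def killVar (s : B) : P B →ₐ[ℂ] P B :=
  aeval fun t => if t = s then 0 else X t

theorem killVar_X_self (s : B) : killVar s (X s) = 0 := by
  simp [killVar]

theorem X_dvd_sub_killVar (s : B) (p : P B) : (X s : P B) ∣ p - killVar s p := by
  let q := Ideal.Quotient.mkₐ ℂ (Ideal.span {(X s : P B)})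
  have hq : q (X s) = 0 := Ideal.Quotient.eq_zero_iff_mem.2 (Ideal.mem_span_singleton_self _)
  have h : q.comp (killVar s) = q := by
    refine MvPolynomial.algHom_ext fun t => ?_
    by_cases ht : t = s
    · subst ht
      simp [killVar_X_self, hq]
    · simp [killVar, ht]
  rw [← Ideal.mem_span_singleton]
  exact Ideal.Quotient.eq.1 (DFunLike.congr_fun h p).symm

theorem killVar_eq_self {s : B} {p : P B} (hp : p ∈ PI s) : killVar s p = p := by
  have h : PI s ≤ AlgHom.equalizer (killVar s) (AlgHom.id ℂ (P B)) := by
    refine Algebra.adjoin_le ?_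
    rintro _ ⟨t, ht, rfl⟩
    have hts : t ≠ s := ht
    simp [killVar, hts]
  exact h hp

theorem killVar_sAct (M : CoxeterMatrix B) (s : B) (p : P B) :
    killVar s (sAct M s p) = killVar s p := by
  obtain ⟨q, hq⟩ := X_dvd_sub_sAct M s p
  have h := congrArg (killVar s) hq
  rw [map_sub, map_mul, killVar_X_self, zero_mul] at h
  exact (sub_eq_zero.1 h).symm

theorem tauMap_tmul (M : CoxeterMatrix B) (s : B) (a b : P B) :
    tauMap M s (a ⊗ₜ[Psub M s] b) = a * sAct M s b := rfl

/-- The multiplication map `θ_s → P`. -/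
noncomputable def mulMap (M : CoxeterMatrix B) (s : B) : theta M s →ₐ[Psub M s] P B :=
  Algebra.TensorProduct.lmul' (Psub M s)

theorem mulMap_tmul (M : CoxeterMatrix B) (s : B) (a b : P B) :
    mulMap M s (a ⊗ₜ[Psub M s] b) = a * b := rfl

theorem mulMap_fmap (M : CoxeterMatrix B) (s : B) (a : P B) :
    mulMap M s (fmap M s a) = 2 * X s * a := by
  change mulMap M s ((a * X s) ⊗ₜ[Psub M s] 1 + a ⊗ₜ[Psub M s] X s) = _
  rw [map_add, mulMap_tmul, mulMap_tmul]
  ring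

theorem tauMap_fmap (M : CoxeterMatrix B) (s : B) (a : P B) :
    tauMap M s (fmap M s a) = 0 := by
  change tauMap M s ((a * X s) ⊗ₜ[Psub M s] 1 + a ⊗ₜ[Psub M s] X s) = _
  rw [map_add, tauMap_tmul, tauMap_tmul, map_one, sAct_X_self]
  ring

theorem two_mul_X_ne_zero (s : B) : (2 * X s : P B) ≠ 0 :=
  mul_ne_zero two_ne_zero (X_ne_zero s)

theorem two_mul_X_dvd {s : B} {p : P B} (h : X s ∣ p) : 2 * X s ∣ p := by
  obtain ⟨q, rfl⟩ := h
  refine ⟨C (1 / 2) * q, ?_⟩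
  have h2 : (2 : P B) * C (1 / 2) = 1 := by
    rw [← map_ofNat (C : ℂ →+* P B) 2, ← C_mul]
    norm_num
  linear_combination (-(X s * q)) * h2

/-- `P` is spanned by `1` and `X s` over the `s`-invariants. -/
theorem exists_eq_add_mul_X (M : CoxeterMatrix B) (s : B) (p : P B) :
    ∃ u v : Psub M s, p = (u : P B) + (v : P B) * X s := by
  obtain ⟨v, hv⟩ := two_mul_X_dvd (X_dvd_sub_sAct M s p)
  have hsv : sAct M s v = v := by
    have h := congrArg (sAct M s) hv
    rw [map_sub, sAct_sAct, map_mul, map_mul, sAct_X_self, map_ofNat] at h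
    refine mul_left_cancel₀ (two_mul_X_ne_zero s) ?_
    linear_combination h + hv
  have hu : sAct M s (p - v * X s) = p - v * X s := by
    rw [map_sub, map_mul, sAct_X_self, hsv]
    linear_combination -hv
  exact ⟨⟨p - v * X s, hu⟩, ⟨v, hsv⟩, by simp⟩

theorem exists_eq_fmap_add_tmul_one (M : CoxeterMatrix B) (s : B) (x : theta M s) :
    ∃ a b : P B, x = fmap M s a + b ⊗ₜ[Psub M s] 1 := by
  induction x using TensorProduct.induction_on with
  | zero => exact ⟨0, 0, by simp⟩
  | add x y hx hy =>
    obtain ⟨a, b, rfl⟩ := hx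
    obtain ⟨c, d, rfl⟩ := hy
    refine ⟨a + c, b + d, ?_⟩
    rw [map_add, TensorProduct.add_tmul]
    abel
  | tmul c d =>
    obtain ⟨u, v, rfl⟩ := exists_eq_add_mul_X M s d
    refine ⟨v • c, u • c - (v • c) * X s, ?_⟩
    change _ = ((v • c) * X s) ⊗ₜ[Psub M s] 1 + (v • c) ⊗ₜ[Psub M s] X s + _
    have hu : (u : P B) = u • (1 : P B) := by simp [Subalgebra.smul_def]
    have hv : (v : P B) * X s = v • (X s : P B) := rfl
    rw [TensorProduct.tmul_add, hu, hv, TensorProduct.sub_tmul, ← TensorProduct.smul_tmul,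
      ← TensorProduct.smul_tmul]
    abel

/-- The map `x ↦ mult(x) - tau(x)|_{X s = 0}`, which is `2 * X s` times the retraction. -/
noncomputable def retractNum (M : CoxeterMatrix B) (s : B) : theta M s →ₗ[ℂ] P B :=
  (mulMap M s).toLinearMap.restrictScalars ℂ -
    (killVar s).toLinearMap ∘ₗ (tauMap M s).toLinearMap.restrictScalars ℂ

theorem retractNum_apply (M : CoxeterMatrix B) (s : B) (x : theta M s) :
    retractNum M s x = mulMap M s x - killVar s (tauMap M s x) := rfl

theorem two_mul_X_dvd_retractNum (M : CoxeterMatrix B) (s : B) (x : theta M s) :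
    2 * X s ∣ retractNum M s x := by
  induction x using TensorProduct.induction_on with
  | zero => simp
  | add x y hx hy => exact map_add (retractNum M s) x y ▸ dvd_add hx hy
  | tmul a b =>
    rw [retractNum_apply, mulMap_tmul, tauMap_tmul, map_mul, killVar_sAct, ← map_mul]
    exact two_mul_X_dvd (X_dvd_sub_killVar s _)

/-- STATEMENT 5: Let `s ∈ S` and `I = S∖{s}`.  The short exact sequence of graded
`P`-bimodules `0 → P → θ_s → Ps → 0`, with first map `a ↦ a(α_s⊗1 + 1⊗α_s)` and second
map `a⊗b ↦ a·s(b)`, splits when regarded as a sequence of graded `(P_I,P_I)`-bimodules.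
(We express the splitting by a `(P_I,P_I)`-bimodule retraction `r` of the first map;
note that the right `P_I`-action on the sub-bimodule `P` is by plain multiplication.) -/
theorem splitting (M : CoxeterMatrix B) (s : B) :
    -- the sequence is a short exact sequence
    Function.Injective (fmap M s)
    ∧ Function.Exact (fmap M s) (tauMap M s)
    ∧ Function.Surjective (tauMap M s)
    -- and it splits over (P_I, P_I)
    ∧ ∃ r : theta M s →ₗ[ℂ] P B,
      (∀ a : P B, r (fmap M s a) = a)
      ∧ (∀ p ∈ PI s, ∀ x : theta M s, r ((p ⊗ₜ[Psub M s] (1 : P B)) * x) = p * r x)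
      ∧ (∀ p ∈ PI s, ∀ x : theta M s, r (x * ((1 : P B) ⊗ₜ[Psub M s] p)) = r x * p) := by
  have hinj : Function.Injective (LinearMap.mulLeft ℂ (2 * X s : P B)) :=
    mul_right_injective₀ (two_mul_X_ne_zero s)
  refine ⟨fun a b hab => ?_, fun x => ⟨fun hx => ?_, ?_⟩, fun a => ⟨a ⊗ₜ 1, ?_⟩, ?_⟩
  · have h := congrArg (mulMap M s) hab
    rw [mulMap_fmap, mulMap_fmap] at h
    exact hinj h
  · obtain ⟨a, b, rfl⟩ := exists_eq_fmap_add_tmul_one M s x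
    rw [map_add, tauMap_fmap, tauMap_tmul, map_one, mul_one, zero_add] at hx
    exact ⟨a, by simp [hx]⟩
  · rintro ⟨a, rfl⟩
    exact tauMap_fmap M s a
  · rw [tauMap_tmul, map_one, mul_one]
  · let r : theta M s →ₗ[ℂ] P B :=
      (LinearEquiv.ofInjective _ hinj).symm.toLinearMap ∘ₗ
        (retractNum M s).codRestrict (LinearMap.range (LinearMap.mulLeft ℂ (2 * X s : P B)))
          fun x => (two_mul_X_dvd_retractNum M s x).imp fun _ h => h.symm
    have hr (x) : 2 * X s * r x = retractNum M s x :=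
      congrArg Subtype.val ((LinearEquiv.ofInjective _ hinj).apply_symm_apply _)
    refine ⟨r, fun a => hinj ?_, fun p hp x => hinj ?_, fun p hp x => hinj ?_⟩
    · change 2 * X s * r _ = 2 * X s * a
      rw [hr, retractNum_apply, mulMap_fmap, tauMap_fmap, map_zero, sub_zero]
    · change 2 * X s * r _ = 2 * X s * (p * r x)
      rw [mul_left_comm, hr, hr, retractNum_apply, retractNum_apply, map_mul, map_mul, map_mul,
        mulMap_tmul, tauMap_tmul, map_one, mul_one, killVar_eq_self hp, mul_sub]
    · change 2 * X s * r _ = 2 * X s * (r x * p)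
      rw [← mul_assoc, hr, hr, retractNum_apply, retractNum_apply, map_mul, map_mul, map_mul,
        mulMap_tmul, tauMap_tmul, one_mul, one_mul, killVar_sAct, killVar_eq_self hp, sub_mul]

end Stmt5
end

section
/- For every s ∈ S, the sequence of graded P-bimodules 0 → P → θ_s → Ps → 0 is exact, where the first map is a ↦ a(α_s⊗1 + 1⊗α_s) (homogeneous of degree 1) and the second map is a⊗b ↦ a·s(b). -/
namespace Stmt6

open MvPolynomial TensorProduct

variable {B : Type*} [Fintype B] [DecidableEq B]

/-- The coefficient `2 cos (π / m_{st})`, so that `s · α_t = α_t + 2cos(π/m_{st}) α_s`. -/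
noncomputable def cc (M : CoxeterMatrix B) (s t : B) : ℂ :=
  ((2 * Real.cos (Real.pi / (M.M s t)) : ℝ) : ℂ)

/-- The polynomial algebra `P = ℂ[V] = Sym(V*)`, in the basis `{α_t}` of `V*`:
the variable `X t` corresponds to `α_t`, placed in degree `1`. -/
abbrev P (B : Type*) : Type _ := MvPolynomial B ℂ

/-- The action of the simple reflection `s` on `P`: `s · α_s = -α_s` and
`s · α_t = α_t + 2cos(π/m_{st}) α_s` for `t ≠ s`. -/
noncomputable def sAct (M : CoxeterMatrix B) (s : B) : P B →ₐ[ℂ] P B :=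
  aeval (fun t => if t = s then - X s else X t + C (cc M s t) * X s)

/-- The subalgebra `P^s` of `s`-invariant polynomials. -/
noncomputable def Psub (M : CoxeterMatrix B) (s : B) : Subalgebra ℂ (P B) :=
  AlgHom.equalizer (sAct M s) (AlgHom.id ℂ (P B))

/-- The graded `P`-bimodule `θ_s = P ⊗_{P^s} P`. -/
abbrev theta (M : CoxeterMatrix B) (s : B) : Type _ :=
  TensorProduct (Psub M s) (P B) (P B)

/-- The first map of the sequence, `a ↦ a·(α_s ⊗ 1 + 1 ⊗ α_s)`. -/
noncomputable def fmap (M : CoxeterMatrix B) (s : B) : P B →ₗ[ℂ] theta M s where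
  toFun a := (a * X s) ⊗ₜ[Psub M s] (1 : P B) + a ⊗ₜ[Psub M s] (X s)
  map_add' a b := by
    simp only [add_mul, TensorProduct.add_tmul]
    abel
  map_smul' c a := by
    simp only [smul_mul_assoc, TensorProduct.smul_tmul', smul_add, RingHom.id_apply]

/-- `s` as a `P^s`-algebra endomorphism of `P`. -/
noncomputable def sActR (M : CoxeterMatrix B) (s : B) : P B →ₐ[Psub M s] P B where
  toRingHom := (sAct M s).toRingHom
  commutes' := fun r => r.2

/-- The second map of the sequence, `θ_s → Ps`, `a ⊗ b ↦ a · s(b)`;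
recall that `Ps` has underlying set `P`, with left action by multiplication and right action
twisted by `s`. -/
noncomputable def tauMap (M : CoxeterMatrix B) (s : B) : theta M s →ₐ[Psub M s] P B :=
  Algebra.TensorProduct.productMap (AlgHom.id (Psub M s) (P B)) (sActR M s)

/-- The degree-`d` homogeneous component of `θ_s` (for the grading in which both tensor
factors `P` carry the polynomial grading with `V*` in degree `1`). -/
noncomputable def thetaDeg (M : CoxeterMatrix B) (s : B) (d : ℕ) :
    Submodule ℂ (theta M s) :=
  Submodule.span ℂ {z : theta M s |
    ∃ (a b : P B) (i j : ℕ), i + j = d ∧ a.IsHomogeneous i ∧ b.IsHomogeneous j ∧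
      z = a ⊗ₜ[Psub M s] b}

section Decomposition

variable {A : Type*} [DecidableEq A] (M : CoxeterMatrix A) (s : A)

lemma sAct_X_self : sAct M s (X s) = -X s := by
  simp [sAct]

lemma X_self_sq_mem_Psub : (X s * X s : P A) ∈ Psub M s := by
  simp [Psub, AlgHom.mem_equalizer, sAct_X_self]

/-- `P` is generated by `1` and `α_s` as a module over `P^s`. -/
lemma exists_eq_add_mul_X (p : P A) : ∃ u v : Psub M s, p = (u : P A) + (v : P A) * X s := by
  induction p using MvPolynomial.induction_on with
  | C c => exact ⟨algebraMap ℂ (Psub M s) c, 0, by simp [MvPolynomial.algebraMap_eq]⟩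
  | add p q hp hq =>
    obtain ⟨u, v, rfl⟩ := hp
    obtain ⟨u', v', rfl⟩ := hq
    exact ⟨u + u', v + v', by push_cast; ring⟩
  | mul_X p t hp =>
    obtain ⟨u, v, rfl⟩ := hp
    obtain ⟨u', v', h⟩ : ∃ u' v' : Psub M s, (X t : P A) = (u' : P A) + (v' : P A) * X s := by
      by_cases hts : t = s
      · exact ⟨0, 1, by simp [hts]⟩
      · refine ⟨⟨X t + C (cc M s t / 2) * X s, ?_⟩, algebraMap ℂ (Psub M s) (-(cc M s t / 2)), ?_⟩
        · have hc : (C (cc M s t) : P A) = C (cc M s t / 2) + C (cc M s t / 2) := by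
            rw [← C_add, add_halves]
          have hC : sAct M s (C (cc M s t / 2)) = C (cc M s t / 2) := by simp [sAct]
          have hX : sAct M s (X t) = X t + C (cc M s t) * X s := by simp [sAct, hts]
          rw [Psub, AlgHom.mem_equalizer, map_add, map_mul, sAct_X_self, hC, hX, hc,
            AlgHom.id_apply]
          ring
        · rw [Subalgebra.coe_algebraMap, MvPolynomial.algebraMap_eq, C_neg]
          ring
    refine ⟨u * u' + v * v' * ⟨X s * X s, X_self_sq_mem_Psub M s⟩, u * v' + v * u', ?_⟩
    rw [h]
    push_cast
    ring

lemma tmul_coe_mul (a b : P A) (u : Psub M s) :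
    a ⊗ₜ[Psub M s] ((u : P A) * b) = (a * u) ⊗ₜ[Psub M s] b := by
  rw [mul_comm a]
  exact (TensorProduct.smul_tmul (R := Psub M s) u a b).symm

lemma tmul_coe (a : P A) (u : Psub M s) :
    a ⊗ₜ[Psub M s] (u : P A) = (a * u) ⊗ₜ[Psub M s] (1 : P A) := by
  simpa only [mul_one] using tmul_coe_mul M s a 1 u

/-- `θ_s` is generated by `1 ⊗ 1` and `1 ⊗ α_s` as a left `P`-module. -/
lemma theta_exists_eq (z : theta M s) :
    ∃ a b : P A, z = a ⊗ₜ[Psub M s] (1 : P A) + b ⊗ₜ[Psub M s] (X s) := by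
  induction z using TensorProduct.induction_on with
  | zero => exact ⟨0, 0, by simp⟩
  | tmul a p =>
    obtain ⟨u, v, rfl⟩ := exists_eq_add_mul_X M s p
    exact ⟨a * u, a * v, by rw [TensorProduct.tmul_add, tmul_coe, tmul_coe_mul]⟩
  | add x y hx hy =>
    obtain ⟨a, b, rfl⟩ := hx
    obtain ⟨a', b', rfl⟩ := hy
    exact ⟨a + a', b + b', by simp only [TensorProduct.add_tmul]; abel⟩

lemma fmap_apply (a : P A) :
    fmap M s a = (a * X s) ⊗ₜ[Psub M s] (1 : P A) + a ⊗ₜ[Psub M s] (X s) := rfl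

lemma tauMap_tmul (a b : P A) : tauMap M s (a ⊗ₜ[Psub M s] b) = a * sAct M s b := rfl

lemma fmap_injective : Function.Injective (fmap M s) := by
  intro a b h
  have hmul (c : P A) : Algebra.TensorProduct.lmul' (Psub M s) (fmap M s c) = c * (2 * X s) := by
    rw [fmap_apply, map_add, Algebra.TensorProduct.lmul'_apply_tmul,
      Algebra.TensorProduct.lmul'_apply_tmul]
    ring
  have h' := congrArg (Algebra.TensorProduct.lmul' (Psub M s)) h
  rw [hmul, hmul] at h'
  exact mul_right_cancel₀ (mul_ne_zero two_ne_zero (X_ne_zero s)) h'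

lemma fmap_tauMap_exact : Function.Exact (fmap M s) (tauMap M s) := by
  intro z
  constructor
  · intro hz
    obtain ⟨a, b, rfl⟩ := theta_exists_eq M s z
    rw [map_add, tauMap_tmul, tauMap_tmul, map_one, sAct_X_self, mul_one, mul_neg,
      add_neg_eq_zero] at hz
    exact ⟨b, by rw [fmap_apply, hz]⟩
  · rintro ⟨a, rfl⟩
    rw [fmap_apply, map_add, tauMap_tmul, tauMap_tmul, map_one, sAct_X_self]
    ring

lemma tauMap_surjective : Function.Surjective (tauMap M s) := fun a =>
  ⟨a ⊗ₜ[Psub M s] (1 : P A), by rw [tauMap_tmul, map_one, mul_one]⟩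

lemma fmap_mul_left (p a : P A) :
    fmap M s (p * a) = (p ⊗ₜ[Psub M s] (1 : P A)) * fmap M s a := by
  simp only [fmap_apply, mul_add, Algebra.TensorProduct.tmul_mul_tmul, one_mul, mul_assoc]

lemma fmap_mul_right (a p : P A) :
    fmap M s (a * p) = fmap M s a * ((1 : P A) ⊗ₜ[Psub M s] p) := by
  obtain ⟨u, v, rfl⟩ := exists_eq_add_mul_X M s p
  have hsq : (a * (v : P A)) ⊗ₜ[Psub M s] (X s * X s : P A) =
      (a * (v : P A) * (X s * X s)) ⊗ₜ[Psub M s] (1 : P A) :=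
    tmul_coe M s (a * v) ⟨X s * X s, X_self_sq_mem_Psub M s⟩
  have hcomm : (X s : P A) * ((u : P A) + (v : P A) * X s) =
      (u : P A) * X s + (v : P A) * (X s * X s) := by ring
  have hleft : a * ((u : P A) + (v : P A) * X s) * X s =
      a * X s * (u : P A) + a * (v : P A) * (X s * X s) := by ring
  have hright : a * ((u : P A) + (v : P A) * X s) = a * (u : P A) + a * X s * (v : P A) := by
    ring
  rw [fmap_apply, fmap_apply, add_mul, Algebra.TensorProduct.tmul_mul_tmul,
    Algebra.TensorProduct.tmul_mul_tmul, one_mul, mul_one, mul_one, hcomm, hleft, hright]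
  simp only [TensorProduct.tmul_add, TensorProduct.add_tmul, tmul_coe, tmul_coe_mul, hsq]
  abel

lemma fmap_mem_thetaDeg {n : ℕ} {a : P A} (ha : a.IsHomogeneous n) :
    fmap M s a ∈ thetaDeg M s (n + 1) :=
  add_mem
    (Submodule.subset_span
      ⟨a * X s, 1, n + 1, 0, rfl, ha.mul (isHomogeneous_X ℂ s), isHomogeneous_one A ℂ, rfl⟩)
    (Submodule.subset_span ⟨a, X s, n, 1, rfl, ha, isHomogeneous_X ℂ s, rfl⟩)

end Decomposition

/-- STATEMENT 6: For every `s ∈ S`, the sequence of graded `P`-bimodules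
`0 → P → θ_s → Ps → 0` is exact, where the first map is `a ↦ a(α_s⊗1 + 1⊗α_s)`
(homogeneous of degree 1, and a map of `P`-bimodules for the regular bimodule structure
on `P`) and the second map is `a⊗b ↦ a·s(b)` (a map of `P`-bimodules for the twisted
right action on the target `Ps`). -/
theorem exact_P_theta_Ps (M : CoxeterMatrix B) (s : B) :
    -- exactness of 0 → P → θ_s → Ps → 0
    Function.Injective (fmap M s)
    ∧ Function.Exact (fmap M s) (tauMap M s)
    ∧ Function.Surjective (tauMap M s)
    -- the first map is a map of `P`-bimodules
    ∧ (∀ p a : P B, fmap M s (p * a) = (p ⊗ₜ[Psub M s] (1 : P B)) * fmap M s a)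
    ∧ (∀ p a : P B, fmap M s (a * p) = fmap M s a * ((1 : P B) ⊗ₜ[Psub M s] p))
    -- the second map is a map of `P`-bimodules (with twisted right action on `Ps`)
    ∧ (∀ (p : P B) (x : theta M s),
        tauMap M s ((p ⊗ₜ[Psub M s] (1 : P B)) * x) = p * tauMap M s x)
    ∧ (∀ (p : P B) (x : theta M s),
        tauMap M s (x * ((1 : P B) ⊗ₜ[Psub M s] p)) = tauMap M s x * sAct M s p)
    -- the first map is homogeneous of degree 1
    ∧ (∀ (n : ℕ) (a : P B), a.IsHomogeneous n → fmap M s a ∈ thetaDeg M s (n + 1)) := by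
  refine ⟨fmap_injective M s, fmap_tauMap_exact M s, tauMap_surjective M s, fmap_mul_left M s,
    fun p a => fmap_mul_right M s a p, fun p x => ?_, fun p x => ?_,
    fun n a ha => fmap_mem_thetaDeg M s ha⟩
  · rw [map_mul, tauMap_tmul, map_one, mul_one]
  · rw [map_mul, tauMap_tmul, one_mul]

end Stmt6
end

section
/- For every s ∈ S, the sequence of graded P-bimodules 0 → Ps → θ_s → P → 0 is exact, where the first map is a ↦ aα_s⊗1 − a⊗α_s (homogeneous of degree 1) and the second map is the multiplication map a⊗b ↦ ab. -/
set_option synthInstance.maxHeartbeats 1000000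
set_option maxHeartbeats 1000000

namespace Stmt7

open MvPolynomial TensorProduct

variable {B : Type*} [Fintype B] [DecidableEq B]

/-- The coefficient `2 cos (π / m_{st})`, so that `s · α_t = α_t + 2cos(π/m_{st}) α_s`. -/
noncomputable def cc (M : CoxeterMatrix B) (s t : B) : ℂ :=
  ((2 * Real.cos (Real.pi / (M.M s t)) : ℝ) : ℂ)

/-- The polynomial algebra `P = ℂ[V] = Sym(V*)`, in the basis `{α_t}` of `V*`:
the variable `X t` corresponds to `α_t`, placed in degree `1`. -/
abbrev P (B : Type*) : Type _ := MvPolynomial B ℂ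

/-- The action of the simple reflection `s` on `P`: `s · α_s = -α_s` and
`s · α_t = α_t + 2cos(π/m_{st}) α_s` for `t ≠ s`. -/
noncomputable def sAct (M : CoxeterMatrix B) (s : B) : P B →ₐ[ℂ] P B :=
  aeval (fun t => if t = s then - X s else X t + C (cc M s t) * X s)

/-- The subalgebra `P^s` of `s`-invariant polynomials. -/
noncomputable def Psub (M : CoxeterMatrix B) (s : B) : Subalgebra ℂ (P B) :=
  AlgHom.equalizer (sAct M s) (AlgHom.id ℂ (P B))

/-- The graded `P`-bimodule `θ_s = P ⊗_{P^s} P`. -/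
abbrev theta (M : CoxeterMatrix B) (s : B) : Type _ :=
  TensorProduct (Psub M s) (P B) (P B)

/-- The first map of the sequence, `a ↦ a·α_s ⊗ 1 − a ⊗ α_s`. -/
noncomputable def gmap (M : CoxeterMatrix B) (s : B) : P B →ₗ[ℂ] theta M s where
  toFun a := (a * X s) ⊗ₜ[Psub M s] (1 : P B) - a ⊗ₜ[Psub M s] (X s)
  map_add' a b := by
    simp only [add_mul, TensorProduct.add_tmul]
    abel
  map_smul' c a := by
    simp only [smul_mul_assoc, TensorProduct.smul_tmul', smul_sub, RingHom.id_apply]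

/-- `s` as a `P^s`-algebra endomorphism of `P`. -/
noncomputable def sActR (M : CoxeterMatrix B) (s : B) : P B →ₐ[Psub M s] P B where
  toRingHom := (sAct M s).toRingHom
  commutes' := fun r => r.2

/-- The second map of the sequence: the multiplication map `θ_s → P`, `a ⊗ b ↦ ab`. -/
noncomputable def multMap (M : CoxeterMatrix B) (s : B) : theta M s →ₐ[Psub M s] P B :=
  Algebra.TensorProduct.lmul' (Psub M s)

/-- The degree-`d` homogeneous component of `θ_s` (for the grading in which both tensor
factors `P` carry the polynomial grading with `V*` in degree `1`). -/
noncomputable def thetaDeg (M : CoxeterMatrix B) (s : B) (d : ℕ) :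
    Submodule ℂ (theta M s) :=
  Submodule.span ℂ {z : theta M s |
    ∃ (a b : P B) (i j : ℕ), i + j = d ∧ a.IsHomogeneous i ∧ b.IsHomogeneous j ∧
      z = a ⊗ₜ[Psub M s] b}

theorem sAct_X_self (M : CoxeterMatrix B) (s : B) : sAct M s (X s) = - X s := by
  simp [sAct]

theorem sAct_sAct (M : CoxeterMatrix B) (s : B) (p : P B) : sAct M s (sAct M s p) = p := by
  have h : (sAct M s).comp (sAct M s) = AlgHom.id ℂ (P B) := by
    ext1 t
    by_cases ht : t = s
    · subst ht
      simp [sAct_X_self]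
    · have hX : sAct M s (X t) = X t + C (cc M s t) * X s := by simp [sAct, ht]
      have hC : sAct M s (C (cc M s t)) = C (cc M s t) := (sAct M s).commutes _
      simp only [AlgHom.comp_apply, AlgHom.id_apply, hX, map_add, map_mul, hC, sAct_X_self]
      ring
  exact DFunLike.congr_fun h p

theorem X_dvd_sub_sAct (M : CoxeterMatrix B) (s : B) (p : P B) : X s ∣ p - sAct M s p := by
  induction p using MvPolynomial.induction_on with
  | C a =>
    have hC : sAct M s (C a) = C a := (sAct M s).commutes _
    simp [hC]
  | add p q hp hq =>
    rw [map_add, add_sub_add_comm]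
    exact dvd_add hp hq
  | mul_X p t hp =>
    have ht : X s ∣ X t - sAct M s (X t) := by
      by_cases ht : t = s
      · subst ht
        rw [sAct_X_self, sub_neg_eq_add]
        exact dvd_add dvd_rfl dvd_rfl
      · exact ⟨-C (cc M s t), by simp [sAct, ht]; ring⟩
    have key : p * X t - sAct M s (p * X t)
        = (p - sAct M s p) * X t + sAct M s p * (X t - sAct M s (X t)) := by
      rw [map_mul]; ring
    rw [key]
    exact dvd_add (hp.mul_right _) (ht.mul_left _)

/-- Every polynomial decomposes over `P^s` along the basis `1, α_s`. -/
theorem exists_eq_add_mul_X (M : CoxeterMatrix B) (s : B) (p : P B) :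
    ∃ u v : Psub M s, p = (u : P B) + (v : P B) * X s := by
  obtain ⟨q, hq⟩ := X_dvd_sub_sAct M s p
  have h2 : C (2⁻¹ : ℂ) * (2 : P B) = 1 := by
    rw [show (2 : P B) = C 2 from (map_ofNat C 2).symm, ← C_mul]
    simp
  have hC : sAct M s (C (2⁻¹ : ℂ)) = C (2⁻¹ : ℂ) := (sAct M s).commutes _
  have hqs : sAct M s q = q := by
    have h := congrArg (sAct M s) hq
    rw [map_sub, map_mul, sAct_sAct, sAct_X_self] at h
    refine mul_left_cancel₀ (X_ne_zero (R := ℂ) s) ?_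
    linear_combination h + hq
  refine ⟨⟨C 2⁻¹ * (p + sAct M s p), ?_⟩, ⟨C 2⁻¹ * q, ?_⟩, ?_⟩
  · change sAct M s _ = _
    rw [map_mul, map_add, sAct_sAct, hC, AlgHom.id_apply, add_comm]
  · change sAct M s _ = _
    rw [map_mul, hC, hqs, AlgHom.id_apply]
  · change p = C 2⁻¹ * (p + sAct M s p) + C 2⁻¹ * q * X s
    linear_combination (-p) * h2 + C 2⁻¹ * hq

theorem tmul_coe_add_coe_mul (M : CoxeterMatrix B) (s : B) (a b : P B) (u v : Psub M s) :
    a ⊗ₜ[Psub M s] ((u : P B) + (v : P B) * b)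
      = (a * u) ⊗ₜ[Psub M s] (1 : P B) + (a * v) ⊗ₜ[Psub M s] b := by
  have h1 : (u : P B) = u • (1 : P B) := by rw [Algebra.smul_def, mul_one]; rfl
  have h2 : (v : P B) * b = v • b := by rw [Algebra.smul_def]; rfl
  have h3 : u • a = a * u := by rw [Algebra.smul_def, mul_comm]; rfl
  have h4 : v • a = a * v := by rw [Algebra.smul_def, mul_comm]; rfl
  rw [tmul_add, h2, ← TensorProduct.smul_tmul, h4]
  conv_lhs => rw [h1]
  rw [← TensorProduct.smul_tmul, h3]

/-- `θ_s` is spanned by `1 ⊗ 1` and `1 ⊗ α_s` as a left `P`-module. -/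
theorem theta_exists_eq (M : CoxeterMatrix B) (s : B) (z : theta M s) :
    ∃ a b : P B, z = a ⊗ₜ[Psub M s] (1 : P B) + b ⊗ₜ[Psub M s] (X s : P B) := by
  induction z using TensorProduct.induction_on with
  | zero => exact ⟨0, 0, by simp⟩
  | tmul a p =>
    obtain ⟨u, v, rfl⟩ := exists_eq_add_mul_X M s p
    exact ⟨_, _, tmul_coe_add_coe_mul M s a (X s) u v⟩
  | add x y hx hy =>
    obtain ⟨a, b, rfl⟩ := hx
    obtain ⟨c, d, rfl⟩ := hy
    exact ⟨a + c, b + d, by rw [add_tmul, add_tmul]; abel⟩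

theorem gmap_apply (M : CoxeterMatrix B) (s : B) (a : P B) :
    gmap M s a = (a * X s) ⊗ₜ[Psub M s] (1 : P B) - a ⊗ₜ[Psub M s] (X s) := rfl

theorem multMap_tmul (M : CoxeterMatrix B) (s : B) (a b : P B) :
    multMap M s (a ⊗ₜ[Psub M s] b) = a * b :=
  Algebra.TensorProduct.lmul'_apply_tmul a b

theorem gmap_injective (M : CoxeterMatrix B) (s : B) : Function.Injective (gmap M s) := by
  rw [injective_iff_map_eq_zero]
  intro a ha
  have h := congrArg (fun z => multMap M s
    (Algebra.TensorProduct.map (AlgHom.id (Psub M s) (P B)) (sActR M s) z)) ha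
  have hX : sActR M s (X s) = - X s := sAct_X_self M s
  simp only [gmap_apply, map_sub, Algebra.TensorProduct.map_tmul, AlgHom.id_apply, map_one,
    map_zero, multMap_tmul, hX] at h
  have h' : (2 * X s : P B) * a = 0 := by linear_combination h
  exact (mul_eq_zero.mp h').resolve_left (mul_ne_zero two_ne_zero (X_ne_zero s))

theorem exact_gmap_multMap (M : CoxeterMatrix B) (s : B) :
    Function.Exact (gmap M s) (multMap M s) := by
  intro z
  constructor
  · intro hz
    obtain ⟨a, b, rfl⟩ := theta_exists_eq M s z
    rw [map_add, multMap_tmul, multMap_tmul, mul_one] at hz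
    refine ⟨-b, ?_⟩
    rw [gmap_apply, neg_tmul, sub_neg_eq_add, eq_neg_of_add_eq_zero_left hz, neg_mul]
  · rintro ⟨a, rfl⟩
    rw [gmap_apply, map_sub, multMap_tmul, multMap_tmul, mul_one, sub_self]

theorem gmap_mul_sAct (M : CoxeterMatrix B) (s : B) (p a : P B) :
    gmap M s (a * sAct M s p) = gmap M s a * ((1 : P B) ⊗ₜ[Psub M s] p) := by
  obtain ⟨u, v, rfl⟩ := exists_eq_add_mul_X M s p
  have hu : sAct M s u = u := u.2
  have hv : sAct M s v = v := v.2
  have hX2 : (X s * X s : P B) ∈ Psub M s := by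
    change sAct M s _ = _
    rw [map_mul, sAct_X_self, neg_mul_neg, AlgHom.id_apply]
  have h := tmul_coe_add_coe_mul M s a (X s) (v * ⟨X s * X s, hX2⟩) u
  have he : (X s : P B) * ((u : P B) + (v : P B) * X s)
      = ((v * ⟨X s * X s, hX2⟩ : Psub M s) : P B) + (u : P B) * X s := by
    simp only [MulMemClass.coe_mul]; ring
  rw [gmap_apply, gmap_apply, map_add, map_mul, hu, hv, sAct_X_self, sub_mul,
    Algebra.TensorProduct.tmul_mul_tmul, Algebra.TensorProduct.tmul_mul_tmul, he, mul_one,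
    mul_one, one_mul, h, tmul_coe_add_coe_mul]
  simp only [MulMemClass.coe_mul, mul_neg, mul_add, add_mul, neg_mul, add_tmul, neg_tmul]
  rw [mul_right_comm a (X s : P B) u, mul_right_comm a (X s : P B) v, ← mul_assoc a (v : P B),
    ← mul_assoc a (v : P B), ← mul_assoc (a * (v : P B))]
  abel

theorem gmap_mem_thetaDeg (M : CoxeterMatrix B) (s : B) (n : ℕ) (a : P B)
    (ha : a.IsHomogeneous n) : gmap M s a ∈ thetaDeg M s (n + 1) :=
  Submodule.sub_mem _
    (Submodule.subset_span
      ⟨_, _, n + 1, 0, rfl, ha.mul (isHomogeneous_X ℂ s), isHomogeneous_one B ℂ, rfl⟩)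
    (Submodule.subset_span ⟨_, _, n, 1, rfl, ha, isHomogeneous_X ℂ s, rfl⟩)

/-- STATEMENT 7: For every `s ∈ S`, the sequence of graded `P`-bimodules
`0 → Ps → θ_s → P → 0` is exact, where the first map is `a ↦ aα_s⊗1 − a⊗α_s`
(homogeneous of degree 1, and a map of `P`-bimodules for the twisted right action on
the source `Ps`) and the second map is the multiplication map `a⊗b ↦ ab`. -/
theorem exact_Ps_theta_P (M : CoxeterMatrix B) (s : B) :
    -- exactness of 0 → Ps → θ_s → P → 0
    Function.Injective (gmap M s)
    ∧ Function.Exact (gmap M s) (multMap M s)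
    ∧ Function.Surjective (multMap M s)
    -- the first map is a map of `P`-bimodules (with twisted right action on `Ps`)
    ∧ (∀ p a : P B, gmap M s (p * a) = (p ⊗ₜ[Psub M s] (1 : P B)) * gmap M s a)
    ∧ (∀ p a : P B, gmap M s (a * sAct M s p) = gmap M s a * ((1 : P B) ⊗ₜ[Psub M s] p))
    -- the second map is a map of `P`-bimodules
    ∧ (∀ (p : P B) (x : theta M s),
        multMap M s ((p ⊗ₜ[Psub M s] (1 : P B)) * x) = p * multMap M s x)
    ∧ (∀ (p : P B) (x : theta M s),
        multMap M s (x * ((1 : P B) ⊗ₜ[Psub M s] p)) = multMap M s x * p)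
    -- the first map is homogeneous of degree 1
    ∧ (∀ (n : ℕ) (a : P B), a.IsHomogeneous n → gmap M s a ∈ thetaDeg M s (n + 1)) := by
  refine ⟨gmap_injective M s, exact_gmap_multMap M s, fun p => ⟨p ⊗ₜ 1, ?_⟩, fun p a => ?_,
    gmap_mul_sAct M s, fun p x => ?_, fun p x => ?_, gmap_mem_thetaDeg M s⟩
  · rw [multMap_tmul, mul_one]
  · rw [gmap_apply, gmap_apply, mul_sub, Algebra.TensorProduct.tmul_mul_tmul,
      Algebra.TensorProduct.tmul_mul_tmul, one_mul, one_mul, mul_assoc]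
  · rw [map_mul, multMap_tmul, mul_one]
  · rw [map_mul, multMap_tmul, one_mul]

end Stmt7
end

section
/- Let s ∈ S with s ∉ Z(W) and I = S∖{s}. There is an isomorphism of two-term complexes of graded (P_I,P_I)-bimodules between the complex θ_s → θ_s⟨1⟩ with differential multiplication by α_s⊗1 − 1⊗α_s (terms in cohomological degrees −1 and 0), and the direct sum of P⟨−1⟩ concentrated in cohomological degree −1 (with zero differential) and the complex Ps → θ_s⟨1⟩ with differential a ↦ aα_s⊗1 − a⊗α_s (terms in cohomological degrees −1 and 0). -/
set_option synthInstance.maxHeartbeats 1000000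
set_option maxHeartbeats 1000000

namespace Stmt8

open MvPolynomial TensorProduct

variable {B : Type*} [Fintype B] [DecidableEq B]

/-- The coefficient `2 cos (π / m_{st})`, so that `s · α_t = α_t + 2cos(π/m_{st}) α_s`. -/
noncomputable def cc (M : CoxeterMatrix B) (s t : B) : ℂ :=
  ((2 * Real.cos (Real.pi / (M.M s t)) : ℝ) : ℂ)

/-- The polynomial algebra `P = ℂ[V] = Sym(V*)`, in the basis `{α_t}` of `V*`:
the variable `X t` corresponds to `α_t`, placed in degree `1`. -/
abbrev P (B : Type*) : Type _ := MvPolynomial B ℂ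

/-- The action of the simple reflection `s` on `P`: `s · α_s = -α_s` and
`s · α_t = α_t + 2cos(π/m_{st}) α_s` for `t ≠ s`. -/
noncomputable def sAct (M : CoxeterMatrix B) (s : B) : P B →ₐ[ℂ] P B :=
  aeval (fun t => if t = s then - X s else X t + C (cc M s t) * X s)

/-- The subalgebra `P^s` of `s`-invariant polynomials. -/
noncomputable def Psub (M : CoxeterMatrix B) (s : B) : Subalgebra ℂ (P B) :=
  AlgHom.equalizer (sAct M s) (AlgHom.id ℂ (P B))

/-- The graded `P`-bimodule `θ_s = P ⊗_{P^s} P`. -/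
abbrev theta (M : CoxeterMatrix B) (s : B) : Type _ :=
  TensorProduct (Psub M s) (P B) (P B)

/-- The degree-`d` homogeneous component of `θ_s` (for the grading in which both tensor
factors `P` carry the polynomial grading with `V*` in degree `1`). -/
noncomputable def thetaDeg (M : CoxeterMatrix B) (s : B) (d : ℕ) :
    Submodule ℂ (theta M s) :=
  Submodule.span ℂ {z : theta M s |
    ∃ (a b : P B) (i j : ℕ), i + j = d ∧ a.IsHomogeneous i ∧ b.IsHomogeneous j ∧
      z = a ⊗ₜ[Psub M s] b}

/-- The graded pieces of `θ_s`, indexed by `ℤ`. -/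
noncomputable def thetaDegZ (M : CoxeterMatrix B) (s : B) (d : ℤ) :
    Submodule ℂ (theta M s) :=
  if 0 ≤ d then thetaDeg M s d.toNat else ⊥

/-- The graded pieces of `P`, indexed by `ℤ`. -/
noncomputable def PDegZ (d : ℤ) : Submodule ℂ (P B) :=
  if 0 ≤ d then MvPolynomial.homogeneousSubmodule B ℂ d.toNat else ⊥

/-- The subalgebra `P_I ⊆ P` for `I = S ∖ {s}`: the subalgebra generated by the
`α_t` for `t ≠ s`. -/
noncomputable def PI (s : B) : Subalgebra ℂ (P B) :=
  Algebra.adjoin ℂ (MvPolynomial.X '' {t : B | t ≠ s})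

section

set_option linter.unusedSectionVars false

lemma sAct_X_self (M : CoxeterMatrix B) (s : B) : sAct M s (X s) = -X s := by
  simp [sAct]

lemma sAct_X_of_ne (M : CoxeterMatrix B) {s t : B} (h : t ≠ s) :
    sAct M s (X t) = X t + C (cc M s t) * X s := by
  simp [sAct, h]

lemma sAct_sAct (M : CoxeterMatrix B) (s : B) (b : P B) : sAct M s (sAct M s b) = b := by
  suffices h : (sAct M s).comp (sAct M s) = AlgHom.id ℂ (P B) from DFunLike.congr_fun h b
  refine MvPolynomial.algHom_ext fun t => ?_
  by_cases h : t = s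
  · subst h; simp [sAct_X_self]
  · have hC : sAct M s (C (cc M s t)) = C (cc M s t) := (sAct M s).commutes _
    simp [sAct_X_of_ne M h, sAct_X_self, hC]

lemma mem_Psub (M : CoxeterMatrix B) (s : B) {b : P B} : b ∈ Psub M s ↔ sAct M s b = b :=
  Iff.rfl

lemma X_dvd_sub_sAct (M : CoxeterMatrix B) (s : B) (b : P B) :
    X s ∣ b - sAct M s b := by
  induction b using MvPolynomial.induction_on with
  | C a =>
    have hC : sAct M s (C a) = C a := (sAct M s).commutes _
    simp [hC]
  | add p q hp hq =>
    rw [map_add, add_sub_add_comm]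
    exact dvd_add hp hq
  | mul_X p t hp =>
    have ht : X s ∣ (X t : P B) - sAct M s (X t) := by
      by_cases h : t = s
      · subst h
        rw [sAct_X_self, sub_neg_eq_add]
        exact dvd_add dvd_rfl dvd_rfl
      · rw [sAct_X_of_ne M h]
        exact ⟨-C (cc M s t), by ring⟩
    rw [map_mul, show p * X t - sAct M s p * sAct M s (X t)
      = (p - sAct M s p) * X t + sAct M s p * (X t - sAct M s (X t)) by ring]
    exact dvd_add (hp.mul_right _) (ht.mul_left _)

/-- The decomposition `P = P^s ⊕ P^s α_s`. -/
lemma exists_eq_add_mul_X (M : CoxeterMatrix B) (s : B) (b : P B) :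
    ∃ b₀ b₁ : Psub M s, b = (b₀ : P B) + (b₁ : P B) * X s := by
  obtain ⟨q, hq⟩ := X_dvd_sub_sAct M s b
  have hC (a : ℂ) : sAct M s (C a) = C a := (sAct M s).commutes _
  have hhalf : (C (1 / 2) : P B) + C (1 / 2) = 1 := by rw [← C_add]; norm_num
  have hqs : sAct M s q = q := by
    have h := congrArg (sAct M s) hq
    rw [map_sub, map_mul, sAct_sAct, sAct_X_self] at h
    refine mul_left_cancel₀ (X_ne_zero (R := ℂ) s) ?_
    linear_combination h + hq
  refine ⟨⟨C (1 / 2) * (b + sAct M s b), ?_⟩, ⟨C (1 / 2) * q, ?_⟩, ?_⟩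
  · rw [mem_Psub, map_mul, map_add, sAct_sAct, hC, add_comm]
  · rw [mem_Psub, map_mul, hC, hqs]
  · linear_combination (-b) * hhalf + C (1 / 2) * hq

lemma X_add_mem_Psub (M : CoxeterMatrix B) {s t : B} (h : t ≠ s) :
    X t + C (cc M s t / 2) * X s ∈ Psub M s := by
  have hC (a : ℂ) : sAct M s (C a) = C a := (sAct M s).commutes _
  have hc : (C (cc M s t) : P B) = C (cc M s t / 2) + C (cc M s t / 2) := by
    rw [← C_add, add_halves]
  rw [mem_Psub, map_add, map_mul, hC, sAct_X_self, sAct_X_of_ne M h, hc]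
  ring

lemma X_mul_X_mem_Psub (M : CoxeterMatrix B) (s : B) : (X s * X s : P B) ∈ Psub M s := by
  rw [mem_Psub, map_mul, sAct_X_self, neg_mul_neg]

/-- Invariant polynomials pass through the tensor sign. -/
lemma one_tmul_eq_tmul_one (M : CoxeterMatrix B) (s : B) {b : P B} (hb : b ∈ Psub M s) :
    (1 : P B) ⊗ₜ[Psub M s] b = b ⊗ₜ[Psub M s] (1 : P B) := by
  have h := TensorProduct.smul_tmul (R := Psub M s) (⟨b, hb⟩ : Psub M s) (1 : P B) (1 : P B)
  simpa [Algebra.smul_def] using h.symm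

/-- The element `α_s ⊗ 1 + 1 ⊗ α_s` of `θ_s`. -/
noncomputable def sumElt (M : CoxeterMatrix B) (s : B) : theta M s :=
  X s ⊗ₜ[Psub M s] (1 : P B) + (1 : P B) ⊗ₜ[Psub M s] X s

/-- The element `α_s ⊗ 1 - 1 ⊗ α_s` of `θ_s`. -/
noncomputable def diffElt (M : CoxeterMatrix B) (s : B) : theta M s :=
  X s ⊗ₜ[Psub M s] (1 : P B) - (1 : P B) ⊗ₜ[Psub M s] X s

lemma tmul_one_mul_tmul_one (M : CoxeterMatrix B) (s : B) (a b : P B) :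
    (a * b) ⊗ₜ[Psub M s] (1 : P B) = (a ⊗ₜ[Psub M s] (1 : P B)) * (b ⊗ₜ[Psub M s] (1 : P B)) := by
  simp

lemma one_tmul_mul (M : CoxeterMatrix B) (s : B) (a b : P B) :
    (1 : P B) ⊗ₜ[Psub M s] (a * b)
      = ((1 : P B) ⊗ₜ[Psub M s] a) * ((1 : P B) ⊗ₜ[Psub M s] b) := by
  simp

lemma tmul_eq_mul (M : CoxeterMatrix B) (s : B) (a b : P B) :
    a ⊗ₜ[Psub M s] b = (a ⊗ₜ[Psub M s] (1 : P B)) * ((1 : P B) ⊗ₜ[Psub M s] b) := by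
  simp

lemma one_tmul_X_mul_self (M : CoxeterMatrix B) (s : B) :
    ((1 : P B) ⊗ₜ[Psub M s] (X s : P B)) * ((1 : P B) ⊗ₜ[Psub M s] (X s : P B))
      = ((X s : P B) ⊗ₜ[Psub M s] (1 : P B)) * ((X s : P B) ⊗ₜ[Psub M s] (1 : P B)) := by
  rw [← one_tmul_mul, ← tmul_one_mul_tmul_one,
    one_tmul_eq_tmul_one M s (X_mul_X_mem_Psub M s)]

lemma one_tmul_mul_sumElt (M : CoxeterMatrix B) (s : B) (b : P B) :
    ((1 : P B) ⊗ₜ[Psub M s] b) * sumElt M s = (b ⊗ₜ[Psub M s] (1 : P B)) * sumElt M s := by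
  obtain ⟨b₀, b₁, rfl⟩ := exists_eq_add_mul_X M s b
  rw [tmul_add, add_tmul, one_tmul_mul, tmul_one_mul_tmul_one, one_tmul_eq_tmul_one M s b₀.2,
    one_tmul_eq_tmul_one M s b₁.2, sumElt]
  linear_combination ((b₁ : P B) ⊗ₜ[Psub M s] (1 : P B)) * one_tmul_X_mul_self M s

lemma one_tmul_mul_diffElt (M : CoxeterMatrix B) (s : B) (b : P B) :
    ((1 : P B) ⊗ₜ[Psub M s] b) * diffElt M s
      = (sAct M s b ⊗ₜ[Psub M s] (1 : P B)) * diffElt M s := by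
  obtain ⟨b₀, b₁, rfl⟩ := exists_eq_add_mul_X M s b
  rw [map_add, map_mul, (mem_Psub M s).1 b₀.2, (mem_Psub M s).1 b₁.2, sAct_X_self, mul_neg,
    tmul_add, add_tmul, neg_tmul, one_tmul_mul, tmul_one_mul_tmul_one,
    one_tmul_eq_tmul_one M s b₀.2, one_tmul_eq_tmul_one M s b₁.2, diffElt]
  linear_combination (-(b₁ : P B) ⊗ₜ[Psub M s] (1 : P B)) * one_tmul_X_mul_self M s

lemma exists_eq_tmul_one_add (M : CoxeterMatrix B) (s : B) (x : theta M s) :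
    ∃ c d : P B, x = c ⊗ₜ[Psub M s] (1 : P B) + (d ⊗ₜ[Psub M s] (1 : P B)) * sumElt M s := by
  induction x using TensorProduct.induction_on with
  | zero => exact ⟨0, 0, by simp⟩
  | tmul a b =>
    obtain ⟨b₀, b₁, rfl⟩ := exists_eq_add_mul_X M s b
    refine ⟨a * (b₀ : P B) - a * (b₁ : P B) * X s, a * (b₁ : P B), ?_⟩
    rw [tmul_eq_mul, tmul_add, one_tmul_mul, one_tmul_eq_tmul_one M s b₀.2,
      one_tmul_eq_tmul_one M s b₁.2, sub_tmul, sumElt]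
    simp only [tmul_one_mul_tmul_one]
    ring
  | add x y hx hy =>
    obtain ⟨c, d, rfl⟩ := hx
    obtain ⟨c', d', rfl⟩ := hy
    exact ⟨c + c', d + d', by simp only [add_tmul]; ring⟩

/-- The action of `s` on `P` as a homomorphism of `P^s`-algebras. -/
noncomputable def sActInv (M : CoxeterMatrix B) (s : B) : P B →ₐ[Psub M s] P B :=
  { sAct M s with commutes' := fun r => r.2 }

/-- The multiplication map `θ_s → P`, `a ⊗ b ↦ a b`. -/
noncomputable def mulMap (M : CoxeterMatrix B) (s : B) : theta M s →ₐ[ℂ] P B :=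
  (Algebra.TensorProduct.lift (AlgHom.id (Psub M s) (P B)) (AlgHom.id (Psub M s) (P B))
    fun _ _ => Commute.all _ _).restrictScalars ℂ

/-- The twisted multiplication map `θ_s → Ps`, `a ⊗ b ↦ a s(b)`. -/
noncomputable def twistedMulMap (M : CoxeterMatrix B) (s : B) : theta M s →ₐ[ℂ] P B :=
  (Algebra.TensorProduct.lift (AlgHom.id (Psub M s) (P B)) (sActInv M s)
    fun _ _ => Commute.all _ _).restrictScalars ℂ

lemma mulMap_tmul (M : CoxeterMatrix B) (s : B) (a b : P B) :
    mulMap M s (a ⊗ₜ[Psub M s] b) = a * b := by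
  simp [mulMap]

lemma twistedMulMap_tmul (M : CoxeterMatrix B) (s : B) (a b : P B) :
    twistedMulMap M s (a ⊗ₜ[Psub M s] b) = a * sAct M s b := by
  simp [twistedMulMap, sActInv]

lemma diffElt_mul (M : CoxeterMatrix B) (s : B) (x : theta M s) :
    diffElt M s * x = (twistedMulMap M s x ⊗ₜ[Psub M s] (1 : P B)) * diffElt M s := by
  induction x using TensorProduct.induction_on with
  | zero => simp
  | tmul a b =>
    rw [twistedMulMap_tmul, tmul_eq_mul, tmul_one_mul_tmul_one]
    linear_combination (a ⊗ₜ[Psub M s] (1 : P B)) * one_tmul_mul_diffElt M s b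
  | add x y hx hy => rw [mul_add, hx, hy, map_add, add_tmul, add_mul]

/-- The `(P_I,P_I)`-bimodule section `Ps → θ_s` of `twistedMulMap`: the algebra homomorphism with
`α_s ↦ (α_s ⊗ 1 - 1 ⊗ α_s) / 2` and `α_t ↦ α_t ⊗ 1` for `t ≠ s`. -/
noncomputable def sectionMap (M : CoxeterMatrix B) (s : B) : P B →ₐ[ℂ] theta M s :=
  aeval fun t => if t = s then (1 / 2 : ℂ) • diffElt M s else X t ⊗ₜ[Psub M s] (1 : P B)

/-- The quotient map `P → P / (α_s) ≅ P_I ⊆ P`. -/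
noncomputable def killX (s : B) : P B →ₐ[ℂ] P B :=
  aeval fun t => if t = s then 0 else X t

lemma sectionMap_of_mem_PI (M : CoxeterMatrix B) (s : B) {p : P B} (hp : p ∈ PI s) :
    sectionMap M s p = p ⊗ₜ[Psub M s] (1 : P B) := by
  have h : PI s ≤ AlgHom.equalizer (sectionMap M s) Algebra.TensorProduct.includeLeft := by
    refine Algebra.adjoin_le ?_
    rintro _ ⟨t, ht, rfl⟩
    have ht' : t ≠ s := ht
    simp [sectionMap, ht']
  exact h hp

lemma sectionMap_sAct_of_mem_PI (M : CoxeterMatrix B) (s : B) {p : P B} (hp : p ∈ PI s) :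
    sectionMap M s (sAct M s p) = (1 : P B) ⊗ₜ[Psub M s] p := by
  have h : PI s ≤ AlgHom.equalizer ((sectionMap M s).comp (sAct M s))
      ((Algebra.TensorProduct.includeRight :
        P B →ₐ[Psub M s] theta M s).restrictScalars ℂ) := by
    refine Algebra.adjoin_le ?_
    rintro _ ⟨t, ht, rfl⟩
    have ht' : t ≠ s := ht
    have hinv := one_tmul_eq_tmul_one M s (X_add_mem_Psub M ht')
    rw [tmul_add, add_tmul, ← smul_eq_C_mul, tmul_smul, ← smul_tmul'] at hinv
    change sectionMap M s (sAct M s (X t)) = (1 : P B) ⊗ₜ[Psub M s] X t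
    rw [sAct_X_of_ne M ht', ← smul_eq_C_mul, map_add, map_smul]
    simp only [sectionMap, aeval_X, if_neg ht', if_true, diffElt, smul_smul, smul_sub]
    rw [mul_one_div]
    rw [← sub_eq_zero] at hinv ⊢
    rw [← neg_eq_zero, ← hinv]
    abel
  exact h hp

lemma twistedMulMap_sectionMap (M : CoxeterMatrix B) (s : B) (a : P B) :
    twistedMulMap M s (sectionMap M s a) = a := by
  suffices h : (twistedMulMap M s).comp (sectionMap M s) = AlgHom.id ℂ (P B) from
    DFunLike.congr_fun h a
  refine MvPolynomial.algHom_ext fun t => ?_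
  by_cases h : t = s
  · subst h
    simp only [sectionMap, AlgHom.comp_apply, aeval_X, if_true, diffElt, map_smul, map_sub,
      twistedMulMap_tmul, sAct_X_self, map_one, AlgHom.id_apply, mul_one, one_mul,
      sub_neg_eq_add, ← two_smul ℂ (X t : P B), smul_smul]
    norm_num
  · simp [sectionMap, h, twistedMulMap_tmul]

lemma mulMap_sectionMap (M : CoxeterMatrix B) (s : B) (a : P B) :
    mulMap M s (sectionMap M s a) = killX s a := by
  suffices h : (mulMap M s).comp (sectionMap M s) = killX s from DFunLike.congr_fun h a
  refine MvPolynomial.algHom_ext fun t => ?_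
  by_cases h : t = s
  · subst h; simp [sectionMap, diffElt, mulMap_tmul, killX]
  · simp [sectionMap, h, mulMap_tmul, killX]

lemma twistedMulMap_sumElt (M : CoxeterMatrix B) (s : B) :
    twistedMulMap M s (sumElt M s) = 0 := by
  simp [sumElt, twistedMulMap_tmul, sAct_X_self]

lemma mulMap_sumElt (M : CoxeterMatrix B) (s : B) :
    mulMap M s (sumElt M s) = X s + X s := by
  simp [sumElt, mulMap_tmul]

/-- The map `P⟨-1⟩ ⊕ Ps → θ_s` splitting `θ_s`. -/
noncomputable def splitMap (M : CoxeterMatrix B) (s : B) : (P B × P B) →ₗ[ℂ] theta M s :=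
  LinearMap.coprod
    ((LinearMap.mulRight ℂ (sumElt M s)).comp
      (Algebra.TensorProduct.includeLeft : P B →ₐ[ℂ] theta M s).toLinearMap)
    (sectionMap M s).toLinearMap

lemma splitMap_apply (M : CoxeterMatrix B) (s : B) (c a : P B) :
    splitMap M s (c, a) = (c ⊗ₜ[Psub M s] (1 : P B)) * sumElt M s + sectionMap M s a := by
  simp [splitMap]

lemma twistedMulMap_splitMap (M : CoxeterMatrix B) (s : B) (y : P B × P B) :
    twistedMulMap M s (splitMap M s y) = y.2 := by
  rw [← Prod.mk.eta (p := y), splitMap_apply, map_add, map_mul, twistedMulMap_sumElt, mul_zero,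
    zero_add, twistedMulMap_sectionMap]

lemma mulMap_splitMap (M : CoxeterMatrix B) (s : B) (y : P B × P B) :
    mulMap M s (splitMap M s y) = X s * (y.1 + y.1) + killX s y.2 := by
  rw [← Prod.mk.eta (p := y), splitMap_apply, map_add, map_mul, mulMap_sumElt,
    mulMap_sectionMap, mulMap_tmul]
  ring

lemma splitMap_bijective (M : CoxeterMatrix B) (s : B) : Function.Bijective (splitMap M s) := by
  constructor
  · refine (injective_iff_map_eq_zero _).2 fun y hy => ?_
    have h₂ := twistedMulMap_splitMap M s y
    have h₁ := mulMap_splitMap M s y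
    rw [hy, map_zero] at h₁ h₂
    rw [← h₂, map_zero, add_zero, eq_comm] at h₁
    exact Prod.ext (self_eq_neg.1 (eq_neg_of_add_eq_zero_left
      ((mul_eq_zero.1 h₁).resolve_left (X_ne_zero s)))) h₂.symm
  · intro x
    obtain ⟨c, d, h⟩ := exists_eq_tmul_one_add M s (x - sectionMap M s (twistedMulMap M s x))
    have hc : c = 0 := by
      have h' := congrArg (twistedMulMap M s) h
      simpa [twistedMulMap_sectionMap, twistedMulMap_tmul, twistedMulMap_sumElt] using h'.symm
    refine ⟨(d, twistedMulMap M s x), ?_⟩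
    rw [hc, zero_tmul, zero_add] at h
    rw [splitMap_apply, ← h, sub_add_cancel]

/-- The isomorphism `θ_s ≅ P⟨-1⟩ ⊕ Ps` of `(P_I,P_I)`-bimodules. -/
noncomputable def splitEquiv (M : CoxeterMatrix B) (s : B) : theta M s ≃ₗ[ℂ] (P B × P B) :=
  (LinearEquiv.ofBijective (splitMap M s) (splitMap_bijective M s)).symm

lemma splitMap_splitEquiv (M : CoxeterMatrix B) (s : B) (x : theta M s) :
    splitMap M s (splitEquiv M s x) = x :=
  (LinearEquiv.ofBijective (splitMap M s) (splitMap_bijective M s)).apply_symm_apply x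

lemma splitEquiv_eq_iff (M : CoxeterMatrix B) (s : B) (x : theta M s) (y : P B × P B) :
    splitEquiv M s x = y ↔ x = splitMap M s y :=
  LinearEquiv.symm_apply_eq _

lemma splitEquiv_snd (M : CoxeterMatrix B) (s : B) (x : theta M s) :
    (splitEquiv M s x).2 = twistedMulMap M s x := by
  rw [← twistedMulMap_splitMap, splitMap_splitEquiv]

lemma X_mul_splitEquiv_fst (M : CoxeterMatrix B) (s : B) (x : theta M s) :
    X s * ((splitEquiv M s x).1 + (splitEquiv M s x).1)
      = mulMap M s x - killX s (twistedMulMap M s x) := by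
  rw [← splitEquiv_snd, eq_sub_iff_add_eq, ← mulMap_splitMap, splitMap_splitEquiv]

lemma splitEquiv_tmul_one_mul (M : CoxeterMatrix B) (s : B) {p : P B} (hp : p ∈ PI s)
    (x : theta M s) : splitEquiv M s ((p ⊗ₜ[Psub M s] (1 : P B)) * x)
      = (p * (splitEquiv M s x).1, p * (splitEquiv M s x).2) := by
  rw [splitEquiv_eq_iff, splitMap_apply, map_mul, sectionMap_of_mem_PI M s hp,
    tmul_one_mul_tmul_one, mul_assoc, ← mul_add, ← splitMap_apply, Prod.mk.eta,
    splitMap_splitEquiv]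

lemma splitEquiv_mul_one_tmul (M : CoxeterMatrix B) (s : B) {p : P B} (hp : p ∈ PI s)
    (x : theta M s) : splitEquiv M s (x * ((1 : P B) ⊗ₜ[Psub M s] p))
      = ((splitEquiv M s x).1 * p, (splitEquiv M s x).2 * sAct M s p) := by
  rw [splitEquiv_eq_iff, splitMap_apply, map_mul, sectionMap_sAct_of_mem_PI M s hp,
    tmul_one_mul_tmul_one, mul_assoc, ← one_tmul_mul_sumElt]
  conv_lhs => rw [← splitMap_splitEquiv M s x, ← Prod.mk.eta (p := splitEquiv M s x),
    splitMap_apply]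
  ring

lemma isHomogeneous_sAct (M : CoxeterMatrix B) (s : B) {b : P B} {n : ℕ}
    (hb : b.IsHomogeneous n) : (sAct M s b).IsHomogeneous n := by
  rw [← one_mul n]
  refine hb.aeval _ fun t => ?_
  split_ifs
  · exact (isHomogeneous_X ℂ s).neg
  · exact (isHomogeneous_X ℂ t).add (isHomogeneous_C_mul_X _ s)

lemma isHomogeneous_killX (s : B) {b : P B} {n : ℕ}
    (hb : b.IsHomogeneous n) : (killX s b).IsHomogeneous n := by
  rw [← one_mul n]
  refine hb.aeval _ fun t => ?_
  split_ifs
  · exact isHomogeneous_zero _ _ _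
  · exact isHomogeneous_X ℂ t

lemma isHomogeneous_mulMap (M : CoxeterMatrix B) (s : B) {d : ℕ} {x : theta M s}
    (hx : x ∈ thetaDeg M s d) : (mulMap M s x).IsHomogeneous d := by
  suffices h : thetaDeg M s d ≤
      (homogeneousSubmodule B ℂ d).comap (mulMap M s).toLinearMap from h hx
  refine Submodule.span_le.2 ?_
  rintro _ ⟨a, b, i, j, rfl, ha, hb, rfl⟩
  change (mulMap M s _).IsHomogeneous _
  rw [mulMap_tmul]
  exact ha.mul hb

lemma isHomogeneous_twistedMulMap (M : CoxeterMatrix B) (s : B) {d : ℕ} {x : theta M s}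
    (hx : x ∈ thetaDeg M s d) : (twistedMulMap M s x).IsHomogeneous d := by
  suffices h : thetaDeg M s d ≤
      (homogeneousSubmodule B ℂ d).comap (twistedMulMap M s).toLinearMap from h hx
  refine Submodule.span_le.2 ?_
  rintro _ ⟨a, b, i, j, rfl, ha, hb, rfl⟩
  change (twistedMulMap M s _).IsHomogeneous _
  rw [twistedMulMap_tmul]
  exact ha.mul (isHomogeneous_sAct M s hb)

lemma mem_PDegZ_sub_one_of_X_mul (s : B) {d : ℕ} {c : P B} (h : (X s * c).IsHomogeneous d) :
    c ∈ PDegZ ((d : ℤ) - 1) := by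
  have hw (m : B →₀ ℕ) : Finsupp.weight 1 m = m.degree := by
    rw [Finsupp.degree_eq_weight_one]; rfl
  have hdeg {m : B →₀ ℕ} (hm : coeff m c ≠ 0) : m.degree + 1 = d := by
    have := h (d := Finsupp.single s 1 + m) (by rwa [coeff_X_mul])
    rw [← this, hw, map_add, Finsupp.degree_single, add_comm]
  unfold PDegZ
  split_ifs with hd
  · intro m hm
    have := hdeg hm
    rw [hw]
    omega
  · rw [Submodule.mem_bot]
    ext m
    by_contra hm
    have := hdeg hm
    omega

end

/-- STATEMENT 8: Let `s ∈ S` with `s ∉ Z(W)` and `I = S∖{s}`.  There is an isomorphism of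
two-term complexes of graded `(P_I,P_I)`-bimodules between the complex `θ_s → θ_s⟨1⟩` with
differential multiplication by `α_s⊗1 − 1⊗α_s` (terms in cohomological degrees `−1` and `0`),
and the direct sum of `P⟨−1⟩` concentrated in cohomological degree `−1` (with zero
differential) and the complex `Ps → θ_s⟨1⟩`, `a ↦ aα_s⊗1 − a⊗α_s` (terms in cohomological
degrees `−1` and `0`).

The isomorphism is given by a pair of bijective `(P_I,P_I)`-bimodule maps `e₁` (in degree
`−1`) and `e₀` (in degree `0`) commuting with the differentials and preserving the gradings;
recall that `Ps` is `P` with right action twisted by `s`, so the right `P_I`-action on the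
second component of the target of `e₁` is twisted by `s`. -/
theorem two_term_decomposition (M : CoxeterMatrix B) {W : Type*} [Group W]
    (cs : CoxeterSystem M W) (s : B) (hs : cs.simple s ∉ Subgroup.center W) :
    ∃ (e₁ : theta M s ≃ₗ[ℂ] (P B × P B)) (e₀ : theta M s ≃ₗ[ℂ] theta M s),
      -- compatibility with the differentials
      (∀ x : theta M s,
        e₀ (((MvPolynomial.X s ⊗ₜ[Psub M s] (1 : P B))
              - ((1 : P B) ⊗ₜ[Psub M s] MvPolynomial.X s)) * x)
          = ((e₁ x).2 * MvPolynomial.X s) ⊗ₜ[Psub M s] (1 : P B)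
              - (e₁ x).2 ⊗ₜ[Psub M s] MvPolynomial.X s)
      -- e₁ is a map of (P_I,P_I)-bimodules
      ∧ (∀ p ∈ PI s, ∀ x : theta M s,
          e₁ ((p ⊗ₜ[Psub M s] (1 : P B)) * x) = (p * (e₁ x).1, p * (e₁ x).2))
      ∧ (∀ p ∈ PI s, ∀ x : theta M s,
          e₁ (x * ((1 : P B) ⊗ₜ[Psub M s] p)) = ((e₁ x).1 * p, (e₁ x).2 * sAct M s p))
      -- e₀ is a map of (P_I,P_I)-bimodules
      ∧ (∀ p ∈ PI s, ∀ x : theta M s,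
          e₀ ((p ⊗ₜ[Psub M s] (1 : P B)) * x) = (p ⊗ₜ[Psub M s] (1 : P B)) * e₀ x)
      ∧ (∀ p ∈ PI s, ∀ x : theta M s,
          e₀ (x * ((1 : P B) ⊗ₜ[Psub M s] p)) = e₀ x * ((1 : P B) ⊗ₜ[Psub M s] p))
      -- e₁ and e₀ respect the gradings (taking the shifts ⟨1⟩, ⟨−1⟩ into account)
      ∧ (∀ (d : ℤ) (x : theta M s), x ∈ thetaDegZ M s d →
          (e₁ x).1 ∈ PDegZ (d - 1) ∧ (e₁ x).2 ∈ PDegZ d)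
      ∧ (∀ (d : ℤ) (x : theta M s), x ∈ thetaDegZ M s d → e₀ x ∈ thetaDegZ M s d) := by
  refine ⟨splitEquiv M s, LinearEquiv.refl ℂ _, fun x => ?_,
    fun p hp x => splitEquiv_tmul_one_mul M s hp x, fun p hp x => splitEquiv_mul_one_tmul M s hp x,
    fun p _ x => rfl, fun p _ x => rfl, fun d x hx => ?_, fun d x hx => hx⟩
  · rw [LinearEquiv.refl_apply, splitEquiv_snd, tmul_one_mul_tmul_one,
      tmul_eq_mul M s (twistedMulMap M s x) (X s), ← mul_sub]
    exact diffElt_mul M s x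
  · by_cases hd : 0 ≤ d
    · lift d to ℕ using hd
      rw [thetaDegZ, if_pos (Int.natCast_nonneg d), Int.toNat_natCast] at hx
      refine ⟨?_, ?_⟩
      · have h : (splitEquiv M s x).1 + (splitEquiv M s x).1 ∈ PDegZ ((d : ℤ) - 1) := by
          refine mem_PDegZ_sub_one_of_X_mul s ?_
          rw [X_mul_splitEquiv_fst]
          exact (isHomogeneous_mulMap M s hx).sub
            (isHomogeneous_killX s (isHomogeneous_twistedMulMap M s hx))
        rw [← two_smul ℂ] at h
        exact ((PDegZ ((d : ℤ) - 1)).smul_mem_iff two_ne_zero).1 h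
      · rw [PDegZ, if_pos (Int.natCast_nonneg d), Int.toNat_natCast, splitEquiv_snd]
        exact isHomogeneous_twistedMulMap M s hx
    · rw [thetaDegZ, if_neg hd, Submodule.mem_bot] at hx
      subst hx
      simp

end Stmt8
end

section
/- For every subset I ⊆ S, V = V_I ⊕ V^I, and the subspace of V* consisting of linear forms vanishing on V^I is exactly span{α_t : t∈I}; consequently the composition span{α_t : t∈I} ↪ V* ↠ (V_I)* (inclusion followed by restriction to V_I) is an isomorphism. -/
open scoped BigOperators

namespace Stmt12

variable {B : Type*} [Fintype B] [DecidableEq B]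

/-- The geometric representation space `V`, with basis `{e_s}` the standard basis. -/
abbrev V (B : Type*) : Type _ := B → ℂ

/-- The basis vector `e_s`. -/
noncomputable def e (s : B) : V B := Pi.single s 1

/-- The entries `α_s(e_t)`: `-2` if `t = s` and `2 cos (π / m_{st})` otherwise. -/
noncomputable def cc (M : CoxeterMatrix B) (s t : B) : ℂ :=
  if t = s then (-2 : ℂ) else ((2 * Real.cos (Real.pi / (M.M s t)) : ℝ) : ℂ)

/-- The linear form `α_s ∈ V*`, determined by `α_s (e_t) = cc M s t`. -/
noncomputable def alpha (M : CoxeterMatrix B) (s : B) : Module.Dual ℂ (V B) :=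
  ∑ t : B, cc M s t • LinearMap.proj t

/-- The action of the simple reflection `s` on `V`: `s(x) = x + α_s(x) e_s`. -/
noncomputable def sigma (M : CoxeterMatrix B) (s : B) : V B →ₗ[ℂ] V B :=
  LinearMap.id + LinearMap.smulRight (alpha M s) (e s)

/-- `V_I`, the span of the `e_t` for `t ∈ I`. -/
noncomputable def VI (I : Set B) : Submodule ℂ (V B) :=
  Submodule.span ℂ (e '' I)

/-- `V^I`, the subspace of vectors fixed by the parabolic subgroup `W_I`; a vector is fixed
by `W_I` if and only if it is fixed by every simple reflection `t ∈ I`. -/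
noncomputable def VupI (M : CoxeterMatrix B) (I : Set B) : Submodule ℂ (V B) :=
  ⨅ t ∈ I, LinearMap.ker (sigma M t - LinearMap.id)

lemma alpha_e (M : CoxeterMatrix B) (s t : B) : alpha M s (e t) = cc M s t := by
  simp [alpha, e, Pi.single_apply]

lemma cc_self {ι : Type*} [DecidableEq ι] (M : CoxeterMatrix ι) (s : ι) : cc M s s = -2 := by
  simp [cc]

lemma cc_symm {ι : Type*} [DecidableEq ι] (M : CoxeterMatrix ι) (s t : ι) :
    cc M s t = cc M t s := by
  simp only [cc, M.symmetric s t, eq_comm]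

lemma sigma_apply (M : CoxeterMatrix B) (s : B) (x : V B) :
    sigma M s x = x + alpha M s x • e s := by
  simp [sigma]

lemma sigma_e_self (M : CoxeterMatrix B) (s : B) : sigma M s (e s) = -e s := by
  rw [sigma_apply, alpha_e, cc_self]
  module

lemma sigma_mul_self (M : CoxeterMatrix B) (s : B) : sigma M s * sigma M s = 1 := by
  refine LinearMap.ext fun x => ?_
  simp only [Module.End.mul_apply, sigma_apply, map_add, map_smul, alpha_e, cc_self,
    Module.End.one_apply]
  module

/-- The product `T` of two simple reflections satisfies `(T - 1) (T² - (c² - 2) T + 1) = 0`: the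
image of `T - 1` lies in the plane of the two roots, where the second factor vanishes. -/
lemma sigma_mul_sigma_cubic (M : CoxeterMatrix B) (s t : B) :
    (sigma M s * sigma M t - 1) *
      ((sigma M s * sigma M t) ^ 2 - (cc M s t ^ 2 - 2) • (sigma M s * sigma M t) + 1) = 0 := by
  refine LinearMap.ext fun x => ?_
  simp only [Module.End.mul_apply, sigma_apply, map_add, map_sub, map_smul, alpha_e, cc_self,
    Module.End.one_apply, pow_two, LinearMap.sub_apply, LinearMap.add_apply,
    LinearMap.smul_apply, LinearMap.zero_apply, cc_symm M t s]
  module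

lemma sigma_mul_sigma_sq (M : CoxeterMatrix B) {s t : B} (h : cc M s t = 0) :
    (sigma M s * sigma M t) ^ 2 = 1 := by
  refine LinearMap.ext fun x => ?_
  simp only [Module.End.mul_apply, sigma_apply, map_add, map_smul, alpha_e, cc_self,
    Module.End.one_apply, pow_two, cc_symm M t s, h]
  module

open Polynomial in
lemma cubic_dvd_X_pow_sub_one {m : ℕ} (hm : 3 ≤ m) {c : ℂ}
    (hc : c = 2 * Complex.cos (Real.pi / m)) :
    (X - 1) * (X ^ 2 - C (c ^ 2 - 2) * X + 1) ∣ (X ^ m - 1 : ℂ[X]) := by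
  have hm0 : m ≠ 0 := by omega
  set ζ : ℂ := Complex.exp (2 * Real.pi * Complex.I / m) with hζdef
  have hζ : IsPrimitiveRoot ζ m := Complex.isPrimitiveRoot_exp m hm0
  have hζ0 : ζ ≠ 0 := Complex.exp_ne_zero _
  have hsum : c ^ 2 - 2 = ζ + ζ⁻¹ := by
    rw [hc, hζdef, ← Complex.exp_neg]
    have h := Complex.cos_sq (Real.pi / m : ℂ)
    have h2 : 2 * Complex.cos (2 * (Real.pi / m : ℂ)) =
        Complex.exp (2 * Real.pi * Complex.I / m) + Complex.exp (-(2 * Real.pi * Complex.I / m)) := by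
      rw [Complex.two_cos]
      congr 2 <;> ring
    rw [← h2, mul_pow, h]
    ring
  have hfactor : (X ^ 2 - C (c ^ 2 - 2) * X + 1 : ℂ[X]) = (X - C ζ) * (X - C ζ⁻¹) := by
    have h1 : (C ζ * C ζ⁻¹ : ℂ[X]) = 1 := by rw [← C_mul, mul_inv_cancel₀ hζ0, C_1]
    rw [hsum, C_add]
    linear_combination -h1
  have hroot : ∀ {z : ℂ}, z ^ m = 1 → (X - C z) ∣ (X ^ m - 1 : ℂ[X]) := fun hz => by
    simp [dvd_iff_isRoot, hz]
  have hne1 : (1 : ℂ) ≠ ζ := (hζ.ne_one (by omega)).symm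
  have hne2 : (1 : ℂ) ≠ ζ⁻¹ := fun h => hne1 (by simpa using congrArg Inv.inv h)
  have hne3 : ζ ≠ ζ⁻¹ := fun h => by
    have h2 : ζ ^ 2 = 1 := by
      rw [pow_two]
      nth_rewrite 2 [h]
      exact mul_inv_cancel₀ hζ0
    have := Nat.le_of_dvd two_pos (hζ.dvd_of_pow_eq_one 2 h2)
    omega
  have hcop : ∀ {a b : ℂ}, a ≠ b → IsCoprime (X - C a) (X - C b) := fun h =>
    isCoprime_X_sub_C_of_isUnit_sub (sub_ne_zero.mpr h).isUnit
  rw [hfactor, ← C_1]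
  refine (IsCoprime.mul_right (hcop hne1) (hcop hne2)).mul_dvd ?_ ((hcop hne3).mul_dvd ?_ ?_)
  · simpa using hroot (one_pow m)
  · simpa using hroot hζ.pow_eq_one
  · simpa only [C_1] using hroot (z := ζ⁻¹) (by rw [inv_pow, hζ.pow_eq_one, inv_one])

/-- The reflections `sigma M s` satisfy the Coxeter relations. -/
lemma sigma_isLiftable (M : CoxeterMatrix B) : M.IsLiftable (sigma M) := by
  intro s t
  rcases eq_or_ne s t with rfl | hst
  · simp [sigma_mul_self]
  have hcc : cc M s t = 2 * Complex.cos (Real.pi / (M.M s t)) := by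
    simp [cc, hst.symm]
  have h1 : M.M s t ≠ 1 := M.off_diagonal s t hst
  rcases Nat.lt_or_ge (M.M s t) 3 with hlt | hge
  · obtain h | h : M.M s t = 0 ∨ M.M s t = 2 := by omega
    · rw [h, pow_zero]
    · rw [h]
      refine sigma_mul_sigma_sq M ?_
      simp [hcc, h]
  · obtain ⟨q, hq⟩ := cubic_dvd_X_pow_sub_one hge hcc
    have h := congrArg (Polynomial.aeval (sigma M s * sigma M t)) hq
    have hcubic : Polynomial.aeval (sigma M s * sigma M t) ((Polynomial.X - 1) *
        (Polynomial.X ^ 2 - Polynomial.C (cc M s t ^ 2 - 2) * Polynomial.X + 1)) = 0 := by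
      rw [← sigma_mul_sigma_cubic M s t, ← Polynomial.smul_eq_C_mul]
      simp
    rw [map_mul, hcubic, zero_mul] at h
    simp only [map_sub, map_pow, Polynomial.aeval_X, map_one] at h
    exact sub_eq_zero.mp h

/-- The geometric representation of the Coxeter group. -/
noncomputable def geometricRep (M : CoxeterMatrix B) : Representation ℂ M.Group (V B) :=
  M.toCoxeterSystem.lift ⟨sigma M, sigma_isLiftable M⟩

lemma geometricRep_simple (M : CoxeterMatrix B) (s : B) :
    geometricRep M (M.toCoxeterSystem.simple s) = sigma M s :=
  M.toCoxeterSystem.lift_apply_simple (sigma_isLiftable M) s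

/-- The linear form `x ↦ ⟨y, x⟩` for the Hermitian inner product obtained from the standard one
by summing over the group. -/
noncomputable def invariantForm {ι G : Type*} [Fintype ι] [Group G] [Fintype G]
    (ρ : Representation ℂ G (V ι)) (y : V ι) : Module.Dual ℂ (V ι) :=
  ∑ g : G, (dotProductBilin ℂ ℂ (star (ρ g y))).comp (ρ g)

lemma invariantForm_apply {ι G : Type*} [Fintype ι] [Group G] [Fintype G]
    (ρ : Representation ℂ G (V ι)) (y x : V ι) :
    invariantForm ρ y x = ∑ g : G, star (ρ g y) ⬝ᵥ ρ g x := by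
  simp [invariantForm]

lemma invariantForm_map {ι G : Type*} [Fintype ι] [Group G] [Fintype G]
    (ρ : Representation ℂ G (V ι)) (h : G) (y x : V ι) :
    invariantForm ρ (ρ h y) (ρ h x) = invariantForm ρ y x := by
  simp only [invariantForm_apply, ← Module.End.mul_apply, ← map_mul]
  exact Equiv.sum_comp (Equiv.mulRight h) fun g => star (ρ g y) ⬝ᵥ ρ g x

open scoped ComplexOrder in
lemma eq_zero_of_invariantForm_self {ι G : Type*} [Fintype ι] [Group G] [Fintype G]
    (ρ : Representation ℂ G (V ι)) {y : V ι} (h : invariantForm ρ y y = 0) : y = 0 := by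
  rw [invariantForm_apply,
    Finset.sum_eq_zero_iff_of_nonneg fun g _ => dotProduct_star_self_nonneg _] at h
  simpa using h 1 (Finset.mem_univ _)

lemma mem_VupI {M : CoxeterMatrix B} {I : Set B} {x : V B} :
    x ∈ VupI M I ↔ ∀ t ∈ I, alpha M t x = 0 := by
  have he : ∀ t : B, e t ≠ 0 := fun t => by simp [e]
  simp [VupI, sigma, he]

lemma VupI_eq_dualCoannihilator (M : CoxeterMatrix B) (I : Set B) :
    VupI M I = (Submodule.span ℂ (alpha M '' I)).dualCoannihilator := by
  ext x
  rw [mem_VupI, Submodule.mem_dualCoannihilator]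
  refine ⟨fun h φ hφ => ?_, fun h t ht => h _ (Submodule.subset_span ⟨t, ht, rfl⟩)⟩
  induction hφ using Submodule.span_induction with
  | mem φ hφ => obtain ⟨t, ht, rfl⟩ := hφ; exact h t ht
  | zero => rfl
  | add φ ψ _ _ hφ hψ => simp [hφ, hψ]
  | smul a φ _ hφ => simp [hφ]

lemma disjoint_VI_VupI (M : CoxeterMatrix B) [Finite M.Group] (I : Set B) :
    Disjoint (VI I) (VupI M I) := by
  have := Fintype.ofFinite M.Group
  rw [Submodule.disjoint_def]
  intro x hxI hx
  have hle : VI I ≤ LinearMap.ker (invariantForm (geometricRep M) x) := by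
    refine Submodule.span_le.mpr ?_
    rintro _ ⟨t, ht, rfl⟩
    have h := invariantForm_map (geometricRep M) (M.toCoxeterSystem.simple t) x (e t)
    rw [geometricRep_simple, sigma_e_self, sigma_apply, mem_VupI.mp hx t ht, zero_smul, add_zero,
      map_neg] at h
    exact neg_eq_self.mp h
  exact eq_zero_of_invariantForm_self _ (hle hxI)

lemma isCompl_VI_VupI (M : CoxeterMatrix B) [Finite M.Group] (I : Set B) :
    IsCompl (VI I) (VupI M I) := by
  classical
  refine (Submodule.isCompl_iff_disjoint _ _ ?_).mpr (disjoint_VI_VupI M I)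
  have hle : Module.finrank ℂ (Submodule.span ℂ (alpha M '' I)) ≤ Module.finrank ℂ (VI I) := by
    have he : LinearIndepOn ℂ e I := by
      have h := (Pi.basisFun ℂ B).linearIndependent
      rw [show ⇑(Pi.basisFun ℂ B) = e from funext fun t => Pi.basisFun_apply ℂ B t] at h
      exact h.linearIndepOn I
    calc _ ≤ Fintype.card I := by
          rw [Set.image_eq_range]
          exact finrank_range_le_card _
      _ = _ := by
          rw [VI, Set.image_eq_range]
          exact (finrank_span_eq_card he).symm
  rw [VupI_eq_dualCoannihilator,
    ← Subspace.finrank_add_finrank_dualCoannihilator_eq (Submodule.span ℂ (alpha M '' I))]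
  gcongr

/-- STATEMENT 12: For every subset `I ⊆ S`, `V = V_I ⊕ V^I`, and the subspace of `V*`
consisting of linear forms vanishing on `V^I` is exactly `span {α_t : t ∈ I}`; consequently
the composition `span {α_t : t ∈ I} ↪ V* ↠ (V_I)*` (inclusion followed by restriction
to `V_I`) is an isomorphism.  (Here `(W,S)` is a finite Coxeter system.) -/
theorem vi_compl_vupi (M : CoxeterMatrix B) [Finite M.Group] (I : Set B) :
    IsCompl (VI I) (VupI M I)
    ∧ (VupI M I).dualAnnihilator = Submodule.span ℂ (alpha M '' I)
    ∧ Function.Bijective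
        (((VI I).dualRestrict).comp (Submodule.span ℂ (alpha M '' I)).subtype) := by
  have hcompl := isCompl_VI_VupI M I
  have hann : (VupI M I).dualAnnihilator = Submodule.span ℂ (alpha M '' I) := by
    rw [VupI_eq_dualCoannihilator, Subspace.dualCoannihilator_dualAnnihilator_eq]
  refine ⟨hcompl, hann, ?_⟩
  rw [← hann]
  constructor
  · rw [injective_iff_map_eq_zero]
    rintro ⟨φ, hφ⟩ h
    rw [Submodule.mem_dualAnnihilator] at hφ
    ext1
    refine LinearMap.ext_on_codisjoint hcompl.codisjoint (fun x hx => ?_) fun x hx => ?_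
    · exact LinearMap.congr_fun h ⟨x, hx⟩
    · exact hφ x hx
  · intro ψ
    refine ⟨⟨LinearMap.ofIsCompl hcompl ψ 0, ?_⟩, ?_⟩
    · rw [Submodule.mem_dualAnnihilator]
      exact fun x hx => LinearMap.ofIsCompl_apply_right hcompl ⟨x, hx⟩
    · ext x
      exact LinearMap.ofIsCompl_apply_left hcompl x

end Stmt12
end

section
/- For every subset I ⊆ S, the two compositions V_I ↪ V ↠ V/V^I and ⋂_{t∈S∖I} ker(α_t) ↪ V ↠ V/V^I are isomorphisms of vector spaces; equivalently, V = V^I ⊕ V_I and V = V^I ⊕ ⋂_{t∈S∖I} ker(α_t). -/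
open scoped BigOperators

namespace Stmt13

variable {B : Type*} [Fintype B] [DecidableEq B]

/-- The geometric representation space `V`, with basis `{e_s}` the standard basis. -/
abbrev V (B : Type*) : Type _ := B → ℂ

/-- The basis vector `e_s`. -/
noncomputable def e (s : B) : V B := Pi.single s 1

/-- The entries `α_s(e_t)`: `-2` if `t = s` and `2 cos (π / m_{st})` otherwise. -/
noncomputable def cc (M : CoxeterMatrix B) (s t : B) : ℂ :=
  if t = s then (-2 : ℂ) else ((2 * Real.cos (Real.pi / (M.M s t)) : ℝ) : ℂ)

/-- The linear form `α_s ∈ V*`, determined by `α_s (e_t) = cc M s t`. -/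
noncomputable def alpha (M : CoxeterMatrix B) (s : B) : Module.Dual ℂ (V B) :=
  ∑ t : B, cc M s t • LinearMap.proj t

/-- The action of the simple reflection `s` on `V`: `s(x) = x + α_s(x) e_s`. -/
noncomputable def sigma (M : CoxeterMatrix B) (s : B) : V B →ₗ[ℂ] V B :=
  LinearMap.id + LinearMap.smulRight (alpha M s) (e s)

/-- `V_I`, the span of the `e_t` for `t ∈ I`. -/
noncomputable def VI (I : Set B) : Submodule ℂ (V B) :=
  Submodule.span ℂ (e '' I)

/-- `V^I`, the subspace of vectors fixed by the parabolic subgroup `W_I`; a vector is fixed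
by `W_I` if and only if it is fixed by every simple reflection `t ∈ I`. -/
noncomputable def VupI (M : CoxeterMatrix B) (I : Set B) : Submodule ℂ (V B) :=
  ⨅ t ∈ I, LinearMap.ker (sigma M t - LinearMap.id)

lemma alpha_apply_e (M : CoxeterMatrix B) (s t : B) : alpha M s (e t) = cc M s t := by
  simp [alpha, e, Pi.single_apply]

lemma cc_self (M : CoxeterMatrix B) (s : B) : cc M s s = -2 := by
  simp [cc]

lemma sigma_apply (M : CoxeterMatrix B) (s : B) (x : V B) :
    sigma M s x = x + alpha M s x • e s := by
  simp [sigma]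

lemma neg_alpha_apply_e_self (M : CoxeterMatrix B) (s : B) : (-alpha M s) (e s) = 2 := by
  simp [alpha_apply_e, cc_self]

lemma sigma_eq_reflection (M : CoxeterMatrix B) (s : B) :
    sigma M s = (Module.reflection (neg_alpha_apply_e_self M s)).toLinearMap := by
  refine LinearMap.ext fun x ↦ ?_
  simp [sigma_apply, Module.reflection_apply]

lemma sigma_mul_self (M : CoxeterMatrix B) (s : B) : sigma M s * sigma M s = 1 := by
  refine LinearMap.ext fun x ↦ ?_
  simp only [Module.End.mul_apply, Module.End.one_apply, sigma_apply, map_add, map_smul,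
    alpha_apply_e, cc_self]
  module

lemma cc_of_ne (M : CoxeterMatrix B) {s t : B} (h : s ≠ t) :
    cc M s t = 2 * Complex.cos (Real.pi / M.M s t) := by
  simp [cc, h.symm]

lemma cc_comm (M : CoxeterMatrix B) (s t : B) : cc M s t = cc M t s := by
  by_cases h : s = t
  · rw [h]
  · rw [cc_of_ne M h, cc_of_ne M (Ne.symm h), M.symmetric t s]

open Polynomial.Chebyshev in
/-- The product of two reflections whose mutual pairings are `-2 cos (π / m)` has order
dividing `m`. -/
lemma reflection_mul_reflection_pow_eq_one {E : Type*} [AddCommGroup E] [Module ℂ E]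
    {f g : Module.Dual ℂ E} {x y : E} (hf : f x = 2) (hg : g y = 2) {m : ℕ} (hm : m ≠ 1)
    (hfy : f y = -(2 * Complex.cos (Real.pi / m)))
    (hgx : g x = -(2 * Complex.cos (Real.pi / m))) :
    (Module.reflection hf * Module.reflection hg) ^ m = 1 := by
  rcases Nat.eq_zero_or_pos m with rfl | hpos
  · simp
  have hmC : (m : ℂ) ≠ 0 := by exact_mod_cast hpos.ne'
  obtain rfl | hm3 : m = 2 ∨ 3 ≤ m := by omega
  · have hc : Complex.cos (Real.pi / (2 : ℕ)) = 0 := by simp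
    rw [hc] at hfy hgx
    ext z
    simp only [pow_two, LinearEquiv.mul_apply, Module.reflection_apply, map_sub, map_smul,
      hf, hg, hfy, hgx, LinearEquiv.coe_one, id_eq]
    module
  set φ : ℂ := 2 * (Real.pi / m) with hφ
  have hmφ : m * φ = 2 * Real.pi := by rw [hφ]; field_simp
  have hsin : Complex.sin φ ≠ 0 := by
    have hφr : φ = ((2 * (Real.pi / m) : ℝ) : ℂ) := by rw [hφ]; push_cast; rfl
    rw [hφr, ← Complex.ofReal_sin]
    have hm3' : (3 : ℝ) ≤ m := by exact_mod_cast hm3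
    have hlt : 2 * (Real.pi / m) < Real.pi := by
      rw [← mul_div_assoc, div_lt_iff₀ (by linarith)]
      nlinarith [Real.pi_pos]
    exact_mod_cast (Real.sin_pos_of_pos_of_lt_pi (by have := Real.pi_pos; positivity) hlt).ne'
  have ht : 2 * Complex.cos φ = f y * g x - 2 := by
    rw [hfy, hgx, hφ, Complex.cos_two_mul]; ring
  have key := Module.reflection_mul_reflection_pow hf hg m (2 * Complex.cos φ) ht
  apply LinearEquiv.toLinearMap_injective
  rw [key]
  have hS := S_two_mul_complex_cos φ
  obtain ⟨k, rfl | rfl⟩ := Nat.even_or_odd' m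
  · have h1 : ((2 * k : ℕ) - 2 : ℤ) / 2 = k - 1 := by omega
    have h2 : ((2 * k : ℕ) - 1 : ℤ) / 2 = k - 1 := by omega
    have h0 : (S ℂ (k - 1)).eval (2 * Complex.cos φ) = 0 := by
      have hk : (((k : ℤ) - 1 : ℤ) + 1 : ℂ) * φ = Real.pi := by
        push_cast at hmφ ⊢
        linear_combination hmφ / 2
      have h := hS (k - 1)
      rw [hk, Complex.sin_pi] at h
      exact (mul_eq_zero.mp h).resolve_right hsin
    rw [h1, h2, h0]
    simp only [zero_mul, zero_smul, add_zero]
    rfl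
  · have h1 : ((2 * k + 1 : ℕ) - 2 : ℤ) / 2 = k - 1 := by omega
    have h2 : ((2 * k + 1 : ℕ) - 1 : ℤ) / 2 = k := by omega
    have h3 : ((2 * k + 1 : ℕ) - 3 : ℤ) / 2 = k - 1 := by omega
    have h4 : ((2 * k + 1 : ℕ) : ℤ) / 2 = k := by omega
    have h0 : (S ℂ k).eval (2 * Complex.cos φ) + (S ℂ (k - 1)).eval (2 * Complex.cos φ) = 0 := by
      have hk : ((k : ℤ) + 1 : ℂ) * φ = 2 * Real.pi - (((k : ℤ) - 1 : ℤ) + 1 : ℂ) * φ := by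
        push_cast at hmφ ⊢
        linear_combination hmφ
      have h := hS k
      rw [hk, Complex.sin_two_pi_sub, ← hS (k - 1)] at h
      refine (mul_eq_zero.mp ?_).resolve_right hsin
      linear_combination h
    rw [h1, h2, h3, h4, h0]
    simp only [mul_zero, zero_smul, add_zero]
    rfl

lemma isLiftable_sigma (M : CoxeterMatrix B) : M.IsLiftable (sigma M) := by
  intro s t
  by_cases h : s = t
  · subst h
    rw [sigma_mul_self, one_pow]
  · have key := reflection_mul_reflection_pow_eq_one (neg_alpha_apply_e_self M s)
      (neg_alpha_apply_e_self M t) (M.off_diagonal s t h)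
      (by rw [LinearMap.neg_apply, alpha_apply_e, cc_of_ne M h])
      (by rw [LinearMap.neg_apply, alpha_apply_e, cc_comm, cc_of_ne M h])
    rw [sigma_eq_reflection, sigma_eq_reflection]
    refine LinearMap.ext fun z ↦ ?_
    have hz := LinearEquiv.congr_fun key z
    rw [LinearEquiv.pow_apply] at hz
    rw [Module.End.pow_apply]
    exact hz

/-- The geometric representation of the Coxeter group. -/
noncomputable def geomRep (M : CoxeterMatrix B) : M.Group →* Module.End ℂ (V B) :=
  M.toCoxeterSystem.lift ⟨sigma M, isLiftable_sigma M⟩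

lemma geomRep_simple (M : CoxeterMatrix B) (s : B) :
    geomRep M (M.toCoxeterSystem.simple s) = sigma M s :=
  M.toCoxeterSystem.lift_apply_simple (isLiftable_sigma M) s

/-- The standard Hermitian form averaged over the Coxeter group. -/
noncomputable def averagedForm (M : CoxeterMatrix B) [Fintype M.Group] (x y : V B) : ℂ :=
  ∑ w : M.Group, star (geomRep M w x) ⬝ᵥ geomRep M w y

section averagedForm

variable (M : CoxeterMatrix B) [Fintype M.Group]

lemma averagedForm_sigma (s : B) (x y : V B) :
    averagedForm M (sigma M s x) (sigma M s y) = averagedForm M x y := by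
  refine Fintype.sum_equiv (Equiv.mulRight (M.toCoxeterSystem.simple s)) _ _ fun w ↦ ?_
  simp only [Equiv.coe_mulRight, map_mul, geomRep_simple, Module.End.mul_apply]

lemma averagedForm_add_right (x y z : V B) :
    averagedForm M x (y + z) = averagedForm M x y + averagedForm M x z := by
  simp [averagedForm, Finset.sum_add_distrib]

lemma averagedForm_neg_left (x y : V B) :
    averagedForm M (-x) y = -averagedForm M x y := by
  simp [averagedForm]

lemma averagedForm_sum_left {ι : Type*} (J : Finset ι) (c : ι → ℂ) (u : ι → V B) (y : V B) :
    averagedForm M (∑ i ∈ J, c i • u i) y = ∑ i ∈ J, star (c i) * averagedForm M (u i) y := by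
  simp only [averagedForm, map_sum, map_smul, star_sum, star_smul, sum_dotProduct,
    smul_dotProduct, smul_eq_mul, Finset.mul_sum]
  exact Finset.sum_comm

open ComplexOrder in
lemma eq_zero_of_averagedForm_self_eq_zero {x : V B} (h : averagedForm M x x = 0) : x = 0 := by
  have h1 := (Finset.sum_eq_zero_iff_of_nonneg
    fun w _ ↦ dotProduct_star_self_nonneg (geomRep M w x)).mp
    (by simpa only [averagedForm, dotProduct_comm] using h) 1 (Finset.mem_univ _)
  simpa using h1

/-- The averaged form pairs `e s` to zero with the kernel of `alpha M s`. -/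
lemma averagedForm_e_eq_zero {s : B} {x : V B} (h : alpha M s x = 0) :
    averagedForm M (e s) x = 0 := by
  have hx : sigma M s x = x := by simp [sigma_apply, h]
  have he : sigma M s (e s) = -e s := by
    rw [sigma_apply, alpha_apply_e, cc_self]; module
  have key := averagedForm_sigma M s (e s) x
  rw [hx, he, averagedForm_neg_left] at key
  exact self_eq_neg.mp key.symm

end averagedForm

lemma sum_smul_e (x : V B) : ∑ t, x t • e t = x := by
  ext b
  simp [e, Pi.single_apply]

lemma eq_zero_of_forall_apply_eq_zero_or_alpha_eq_zero (M : CoxeterMatrix B) [Finite M.Group]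
    {x : V B} (h : ∀ t, x t = 0 ∨ alpha M t x = 0) : x = 0 := by
  have := Fintype.ofFinite M.Group
  apply eq_zero_of_averagedForm_self_eq_zero M
  conv_lhs => rw [← sum_smul_e x]
  rw [averagedForm_sum_left]
  refine Finset.sum_eq_zero fun t _ ↦ ?_
  rw [sum_smul_e]
  rcases h t with h | h
  · simp [h]
  · simp [averagedForm_e_eq_zero M h]

lemma mem_VupI {M : CoxeterMatrix B} {I : Set B} {x : V B} :
    x ∈ VupI M I ↔ ∀ t ∈ I, alpha M t x = 0 := by
  simp [VupI, Submodule.mem_iInf, sigma_apply, e]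

lemma mem_VI {I : Set B} {x : V B} : x ∈ VI I ↔ ∀ t ∉ I, x t = 0 := by
  constructor
  · intro hx t ht
    have hle : VI I ≤ LinearMap.ker (LinearMap.proj t : V B →ₗ[ℂ] ℂ) := by
      refine Submodule.span_le.mpr ?_
      rintro _ ⟨s, hs, rfl⟩
      have hne : t ≠ s := by rintro rfl; exact ht hs
      simp [e, hne]
    exact hle hx
  · intro h
    rw [← sum_smul_e x]
    refine Submodule.sum_mem _ fun t _ ↦ ?_
    by_cases ht : t ∈ I
    · exact Submodule.smul_mem _ _ (Submodule.subset_span ⟨t, ht, rfl⟩)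
    · simp [h t ht]

lemma isCompl_VupI_VI (M : CoxeterMatrix B) [Finite M.Group] (I : Set B) :
    IsCompl (VupI M I) (VI I) := by
  classical
  let F : V B →ₗ[ℂ] V B :=
    LinearMap.pi fun t ↦ if t ∈ I then alpha M t else LinearMap.proj t
  have hF : ∀ x t, F x t = if t ∈ I then alpha M t x else x t := by
    intro x t
    by_cases ht : t ∈ I <;> simp [F, ht]
  have hinj : ∀ x, F x = 0 → x = 0 := by
    refine fun x hx ↦ eq_zero_of_forall_apply_eq_zero_or_alpha_eq_zero M fun t ↦ ?_
    have h := hF x t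
    rw [hx] at h
    by_cases ht : t ∈ I <;> simp_all
  constructor
  · rw [Submodule.disjoint_def]
    intro x h1 h2
    rw [mem_VupI] at h1
    rw [mem_VI] at h2
    exact eq_zero_of_forall_apply_eq_zero_or_alpha_eq_zero M fun t ↦ by
      by_cases ht : t ∈ I
      exacts [.inr (h1 t ht), .inl (h2 t ht)]
  · rw [codisjoint_iff, Submodule.eq_top_iff']
    intro x
    obtain ⟨y, hy⟩ := LinearMap.injective_iff_surjective.mp
      ((injective_iff_map_eq_zero F).mpr hinj) fun t ↦ if t ∈ I then alpha M t x else 0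
    refine Submodule.mem_sup.mpr ⟨x - y, mem_VupI.mpr fun t ht ↦ ?_, y,
      mem_VI.mpr fun t ht ↦ ?_, sub_add_cancel x y⟩
    all_goals
      have h := hF y t
      rw [hy] at h
      simp_all

lemma isCompl_VupI_iInf_ker (M : CoxeterMatrix B) [Finite M.Group] (I : Set B) :
    IsCompl (VupI M I) (⨅ t ∈ Iᶜ, LinearMap.ker (alpha M t)) := by
  classical
  have hmem : ∀ x, x ∈ (⨅ t ∈ Iᶜ, LinearMap.ker (alpha M t)) ↔ ∀ t ∉ I, alpha M t x = 0 := by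
    simp [Submodule.mem_iInf]
  have hinj : ∀ x, LinearMap.pi (alpha M) x = 0 → x = 0 := fun x hx ↦
    eq_zero_of_forall_apply_eq_zero_or_alpha_eq_zero M fun t ↦ .inr (congrFun hx t)
  constructor
  · rw [Submodule.disjoint_def]
    intro x h1 h2
    rw [mem_VupI] at h1
    rw [hmem] at h2
    exact eq_zero_of_forall_apply_eq_zero_or_alpha_eq_zero M fun t ↦
      .inr (by by_cases ht : t ∈ I; exacts [h1 t ht, h2 t ht])
  · rw [codisjoint_iff, Submodule.eq_top_iff']
    intro x
    obtain ⟨y, hy⟩ := LinearMap.injective_iff_surjective.mp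
      ((injective_iff_map_eq_zero (LinearMap.pi (alpha M))).mpr hinj)
      fun t ↦ if t ∈ I then alpha M t x else 0
    refine Submodule.mem_sup.mpr ⟨x - y, mem_VupI.mpr fun t ht ↦ ?_, y,
      (hmem y).mpr fun t ht ↦ ?_, sub_add_cancel x y⟩
    all_goals
      have h := congrFun hy t
      rw [LinearMap.pi_apply] at h
      simp [h, ht]

lemma bijective_mkQ_comp_subtype_of_isCompl {R E : Type*} [Ring R] [AddCommGroup E] [Module R E]
    {p q : Submodule R E} (h : IsCompl p q) : Function.Bijective (p.mkQ.comp q.subtype) :=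
  (Submodule.quotientEquivOfIsCompl p q h).symm.bijective

/-- STATEMENT 13: For every subset `I ⊆ S`, the two compositions `V_I ↪ V ↠ V/V^I` and
`⋂_{t∈S∖I} ker α_t ↪ V ↠ V/V^I` are isomorphisms of vector spaces; equivalently,
`V = V^I ⊕ V_I` and `V = V^I ⊕ ⋂_{t∈S∖I} ker α_t`.
(Here `(W,S)` is a finite Coxeter system.) -/
theorem compositions_bijective (M : CoxeterMatrix B) [Finite M.Group] (I : Set B) :
    Function.Bijective ((VupI M I).mkQ.comp (VI I).subtype)
    ∧ Function.Bijective
        ((VupI M I).mkQ.comp (⨅ t ∈ Iᶜ, LinearMap.ker (alpha M t)).subtype)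
    ∧ IsCompl (VupI M I) (VI I)
    ∧ IsCompl (VupI M I) (⨅ t ∈ Iᶜ, LinearMap.ker (alpha M t)) := by
  exact ⟨bijective_mkQ_comp_subtype_of_isCompl (isCompl_VupI_VI M I),
    bijective_mkQ_comp_subtype_of_isCompl (isCompl_VupI_iInf_ker M I),
    isCompl_VupI_VI M I, isCompl_VupI_iInf_ker M I⟩

end Stmt13
end
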